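/- Let L/K satisfy condition (ram) with parameter n ≥ 1, with G^1 cyclic with generator γ and K unramified over ℚ_p. Put S^1 = {γ^i : 0 ≤ i ≤ p^{n−1}−1} and X = {x ∈ m_L : v_L(x) < p}. Then for any α ∈ O_K + X there exists β ∈ O_L such that v_π(Σ_{σ∈S^1} Tr_{L/K}(α^σ β)) = n. -/

import Mathlib

noncomputable section

open scoped Classical

/-- An additive `ℚ ∪ {∞}`-valued valuation on a field `A`, normalized by `v p = 1`.
This models the `p`-adic valuation `v_p` on (an algebraic closure of) `ℚ_p`,
with the convention `v 0 = ∞`. -/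
structure PadicValData (A : Type) [Field A] (p : ℕ) : Type where
  v : A → WithTop ℚ
  v_top_iff : ∀ x : A, v x = ⊤ ↔ x = 0
  v_mul : ∀ x y : A, v (x * y) = v x + v y
  v_min_le_add : ∀ x y : A, min (v x) (v y) ≤ v (x + y)
  v_coe_p : v (p : A) = 1

variable {p : ℕ} {A : Type} [Field A]

/-- `x ∈ F` is a uniformizer of the `p`-adic field `F` (embedded in `A` by `emb`):
its valuation is minimal among the positive valuations of elements of `F`. -/
def IsUniformizer (vd : PadicValData A p) {F : Type} [Field F] (emb : F →+* A) (x : F) : Prop :=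
  x ≠ 0 ∧ 0 < vd.v (emb x) ∧
    ∀ y : F, 0 < vd.v (emb y) → vd.v (emb x) ≤ vd.v (emb y)

/-- `y` belongs to the `j`-th power `m_F^j` of the maximal ideal of the ring of integers
`O_F` of `F` (embedded in `A` by `emb`): `y` is a multiple, by an element of `O_F`, of a
product of `j` elements of the maximal ideal `m_F`.  (For `j = 0` this says `y ∈ O_F`.) -/
def InMaxIdealPow (vd : PadicValData A p) {F : Type} [Field F] (emb : F →+* A) (j : ℕ)
    (y : A) : Prop :=
  ∃ (u : F) (s : Fin j → F), 0 ≤ vd.v (emb u) ∧ (∀ k, 0 < vd.v (emb (s k))) ∧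
    y = emb u * ∏ k, emb (s k)

/-- The lower-numbering ramification set
`G_i = {σ ∈ Gal(L/K) | ∀ x ∈ O_L, σ x - x ∈ m_L^{i+1}}` (with `G_i = G` for `i ≤ -1`). -/
def lowerRamSet (vd : PadicValData A p) (K L : Type) [Field K] [Field L] [Algebra K L]
    (emb : L →+* A) (i : ℤ) : Set (L ≃ₐ[K] L) :=
  {σ | ∀ x : L, 0 ≤ vd.v (emb x) →
    InMaxIdealPow vd emb (i + 1).toNat (emb (σ x) - emb x)}

/-- The Herbrand function `φ_{L/K}(u) = ∫_0^u dt / (G_0 : G_t)`, where `G_t = G_{⌈t⌉}`. -/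
noncomputable def herbrandPhi (vd : PadicValData A p) (K L : Type) [Field K] [Field L]
    [Algebra K L] (emb : L →+* A) (u : ℝ) : ℝ :=
  ∫ t in (0:ℝ)..u,
    (Nat.card ↥(lowerRamSet vd K L emb ⌈t⌉) : ℝ) /
      (Nat.card ↥(lowerRamSet vd K L emb 0) : ℝ)

/-- The Herbrand function `ψ_{L/K}`, the inverse of `φ_{L/K}`. -/
noncomputable def herbrandPsi (vd : PadicValData A p) (K L : Type) [Field K] [Field L]
    [Algebra K L] (emb : L →+* A) (w : ℝ) : ℝ :=
  Function.invFun (herbrandPhi vd K L emb) w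

/-- The upper-numbering ramification set `G^i = G_{ψ_{L/K}(i)}` of `Gal(L/K)`. -/
def upperRamSet (vd : PadicValData A p) (K L : Type) [Field K] [Field L] [Algebra K L]
    (emb : L →+* A) (i : ℤ) : Set (L ≃ₐ[K] L) :=
  lowerRamSet vd K L emb ⌈herbrandPsi vd K L emb (i : ℝ)⌉

/-- Condition (ram): the upper ramification groups of `L/K` satisfy
`G = G^{-1} = G^0 ⊇ G^1 ⊋ G^2 ⊋ ⋯ ⊋ G^n ⊋ G^{n+1} = {1}`, with `G^i/G^{i+1}` of order `p`
for `1 ≤ i ≤ n` and `G^0/G^1` of order `p - 1`. -/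
def RamCond (vd : PadicValData A p) (K L : Type) [Field K] [Field L] [Algebra K L]
    (emb : L →+* A) (n : ℕ) : Prop :=
  upperRamSet vd K L emb (-1) = Set.univ ∧
  upperRamSet vd K L emb 0 = Set.univ ∧
  (∀ i : ℤ, upperRamSet vd K L emb (i + 1) ⊆ upperRamSet vd K L emb i) ∧
  Nat.card ↥(upperRamSet vd K L emb 0)
    = (p - 1) * Nat.card ↥(upperRamSet vd K L emb 1) ∧
  (∀ i : ℕ, 1 ≤ i → i ≤ n →
    Nat.card ↥(upperRamSet vd K L emb (i : ℤ))
      = p * Nat.card ↥(upperRamSet vd K L emb ((i : ℤ) + 1))) ∧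
  upperRamSet vd K L emb ((n : ℤ) + 1) = {1}

/-- The local resolvent `⟨α|χ⟩ = ∑_{γ ∈ Gal(L/K)} χ(γ) γ(α)`, computed in `A`. -/
noncomputable def localResolvent (K L : Type) [Field K] [Field L] [Algebra K L]
    (emb : L →+* A) (χ : (L ≃ₐ[K] L) → A) (α : L) : A :=
  ∑ᶠ γ : L ≃ₐ[K] L, χ γ * emb (γ α)

end

/-! ### Part 1 -/

section

/-- A discrete integer-valued valuation (value at `0` irrelevant). -/
structure DV (L : Type) [Field L] where
  w : L → ℤ
  mul' : ∀ x y, x ≠ 0 → y ≠ 0 → w (x * y) = w x + w y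
  add' : ∀ x y, x ≠ 0 → y ≠ 0 → x + y ≠ 0 → min (w x) (w y) ≤ w (x + y)

namespace DV
variable {L : Type} [Field L] (V : DV L)

def Ge (m : ℤ) (x : L) : Prop := x = 0 ∨ m ≤ V.w x

lemma ge_zero (m : ℤ) : V.Ge m 0 := Or.inl rfl
lemma ge_self (x : L) : V.Ge (V.w x) x := Or.inr le_rfl
lemma w_one : V.w 1 = 0 := by
  have := V.mul' 1 1 one_ne_zero one_ne_zero
  rw [mul_one] at this; omega
lemma w_neg (x : L) (hx : x ≠ 0) : V.w (-x) = V.w x := by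
  have h1 := V.mul' (-1) (-1) (by simp) (by simp)
  have h0 := V.w_one
  have h2 := V.mul' (-1) x (by simp) hx
  have h3 : V.w (-1 * -1 : L) = 0 := by rw [← h0]; congr 1; ring
  have h4 : V.w (-1 * x) = V.w (-x) := by congr 1; ring
  omega
lemma ge_mono {m k : ℤ} {x : L} (h : k ≤ m) (hx : V.Ge m x) : V.Ge k x := by
  rcases hx with h1 | h1
  · exact Or.inl h1
  · exact Or.inr (h.trans h1)
lemma ge_neg {m : ℤ} {x : L} (hx : V.Ge m x) : V.Ge m (-x) := by
  by_cases h : x = 0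
  · subst h; simpa using hx
  · rcases hx with h1 | h1
    · exact absurd h1 h
    · exact Or.inr (by rw [V.w_neg x h]; exact h1)
lemma ge_add {m : ℤ} {x y : L} (hx : V.Ge m x) (hy : V.Ge m y) : V.Ge m (x + y) := by
  by_cases h : x = 0
  · subst h; simpa using hy
  by_cases h' : y = 0
  · subst h'; simpa using hx
  by_cases hs : x + y = 0
  · exact Or.inl hs
  · rcases hx with h1 | h1
    · exact absurd h1 h
    rcases hy with h2 | h2
    · exact absurd h2 h'
    exact Or.inr ((le_min h1 h2).trans (V.add' x y h h' hs))
lemma ge_sub {m : ℤ} {x y : L} (hx : V.Ge m x) (hy : V.Ge m y) : V.Ge m (x - y) := by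
  rw [sub_eq_add_neg]; exact V.ge_add hx (V.ge_neg hy)
lemma ge_mul {m k : ℤ} {x y : L} (hx : V.Ge m x) (hy : V.Ge k y) : V.Ge (m + k) (x * y) := by
  by_cases h : x = 0
  · subst h; simp [Ge]
  by_cases h' : y = 0
  · subst h'; simp [Ge]
  rcases hx with h1 | h1
  · exact absurd h1 h
  rcases hy with h2 | h2
  · exact absurd h2 h'
  exact Or.inr (by rw [V.mul' x y h h']; omega)
lemma ge_one : V.Ge 0 1 := Or.inr (by rw [V.w_one])
lemma ge_sum {ι : Type*} (s : Finset ι) (f : ι → L) (m : ℤ) (h : ∀ i ∈ s, V.Ge m (f i)) :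
    V.Ge m (∑ i ∈ s, f i) := by
  classical
  induction s using Finset.induction_on with
  | empty => simpa using V.ge_zero m
  | insert a s ha ih =>
    rw [Finset.sum_insert ha]
    exact V.ge_add (h a (by simp)) (ih fun i hi => h i (by simp [hi]))
lemma ge_prod {ι : Type*} (s : Finset ι) (f : ι → L) (h : ∀ i ∈ s, V.Ge 0 (f i)) :
    V.Ge 0 (∏ i ∈ s, f i) := by
  classical
  induction s using Finset.induction_on with
  | empty => simpa using V.ge_one
  | insert a s ha ih =>
    rw [Finset.prod_insert ha]
    exact V.ge_mul (m := 0) (k := 0) (h a (by simp)) (ih fun i hi => h i (by simp [hi]))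
lemma ge_nat (k : ℕ) : V.Ge 0 (k : L) := by
  induction k with
  | zero => simpa using V.ge_zero 0
  | succ k ih => push_cast; exact V.ge_add ih V.ge_one
lemma ge_int (k : ℤ) : V.Ge 0 (k : L) := by
  obtain ⟨n, rfl | rfl⟩ := k.eq_nat_or_neg
  · simpa using V.ge_nat n
  · simpa using V.ge_neg (V.ge_nat n)
lemma ge_pow {x : L} (hx : V.Ge 0 x) (k : ℕ) : V.Ge 0 (x ^ k) := by
  induction k with
  | zero => simpa using V.ge_one
  | succ k ih => rw [pow_succ]; exact V.ge_mul (m := 0) (k := 0) ih hx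
lemma w_pow {x : L} (hx : x ≠ 0) (k : ℕ) : V.w (x ^ k) = k * V.w x := by
  induction k with
  | zero => simp [V.w_one]
  | succ k ih => rw [pow_succ, V.mul' _ _ (pow_ne_zero _ hx) hx, ih]; push_cast; ring
lemma w_prod {ι : Type*} (s : Finset ι) (f : ι → L) (h : ∀ i ∈ s, f i ≠ 0) :
    V.w (∏ i ∈ s, f i) = ∑ i ∈ s, V.w (f i) := by
  classical
  induction s using Finset.induction_on with
  | empty => simpa using V.w_one
  | insert a s ha ih =>
    rw [Finset.prod_insert ha, Finset.sum_insert ha, V.mul' _ _ (h a (by simp)), ih]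
    · exact fun i hi => h i (by simp [hi])
    · exact Finset.prod_ne_zero_iff.mpr fun i hi => h i (by simp [hi])
lemma w_inv {x : L} (hx : x ≠ 0) : V.w x⁻¹ = - V.w x := by
  have := V.mul' x x⁻¹ hx (inv_ne_zero hx)
  rw [mul_inv_cancel₀ hx, V.w_one] at this; omega
lemma w_div {x y : L} (hx : x ≠ 0) (hy : y ≠ 0) : V.w (x / y) = V.w x - V.w y := by
  rw [div_eq_mul_inv, V.mul' _ _ hx (inv_ne_zero hy), V.w_inv hy]; ring
lemma w_zpow {x : L} (hx : x ≠ 0) (k : ℤ) : V.w (x ^ k) = k * V.w x := by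
  obtain ⟨n, rfl | rfl⟩ := k.eq_nat_or_neg
  · simpa using V.w_pow hx n
  · rw [zpow_neg, zpow_natCast, V.w_inv (pow_ne_zero _ hx), V.w_pow hx]; ring
lemma le_w {m : ℤ} {x : L} (h0 : x ≠ 0) (hx : V.Ge m x) : m ≤ V.w x := by
  rcases hx with h | h
  · exact absurd h h0
  · exact h
/-- `x` has valuation `m`, `y` larger -/
lemma eq_add {m : ℤ} {x y : L} (h0 : x ≠ 0) (hx : V.w x = m) (hy : V.Ge (m + 1) y) :
    x + y ≠ 0 ∧ V.w (x + y) = m := by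
  have hne : x + y ≠ 0 := by
    intro h
    have hy' : y = -x := by linear_combination h
    subst hy'
    have := V.le_w (neg_ne_zero.mpr h0) hy
    rw [V.w_neg x h0] at this; omega
  refine ⟨hne, ?_⟩
  have h1 : m ≤ V.w (x + y) := V.le_w hne (V.ge_add (hx ▸ V.ge_self x) (V.ge_mono (by omega) hy))
  by_contra hlt
  have h2 : V.Ge (m + 1) (x + y) := Or.inr (by omega)
  have h3 := V.le_w h0 (by simpa using V.ge_sub h2 hy)
  omega
lemma eq_zero_of_ge {x : L} (h : ∀ m : ℕ, V.Ge m x) : x = 0 := by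
  by_contra h0
  have := V.le_w h0 (h ((V.w x).toNat + 1))
  push_cast at this
  omega
lemma ge_div {m : ℤ} {x y : L} (hy : y ≠ 0) (hx : V.Ge m x) : V.Ge (m - V.w y) (x / y) := by
  rw [div_eq_mul_inv, sub_eq_add_neg]
  refine V.ge_mul hx (Or.inr ?_)
  rw [V.w_inv hy]

lemma sum_distinct {ι : Type*} [DecidableEq ι] (s : Finset ι) (f : ι → L)
    (h : ∀ i ∈ s, ∀ j ∈ s, f i ≠ 0 → f j ≠ 0 → V.w (f i) = V.w (f j) → i = j)
    (hne : ∃ i ∈ s, f i ≠ 0) :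
    ∑ i ∈ s, f i ≠ 0 ∧ ∃ i ∈ s, f i ≠ 0 ∧ V.w (∑ i ∈ s, f i) = V.w (f i) := by
  classical
  obtain ⟨i, hi, hmin⟩ := Finset.exists_min_image (s.filter fun i => f i ≠ 0) (fun i => V.w (f i))
    (by obtain ⟨i, hi, h0⟩ := hne; exact ⟨i, by simp [hi, h0]⟩)
  simp only [Finset.mem_filter] at hi hmin
  rw [← Finset.add_sum_erase s f hi.1]
  have := V.eq_add (m := V.w (f i)) (y := ∑ j ∈ s.erase i, f j) hi.2 rfl (V.ge_sum _ _ _ (by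
    intro j hj
    rw [Finset.mem_erase] at hj
    by_cases h0 : f j = 0
    · exact Or.inl h0
    · right
      have h1 := hmin j ⟨hj.2, h0⟩
      have h2 : V.w (f j) ≠ V.w (f i) := fun he => hj.1 (h j hj.2 i hi.1 h0 hi.2 he)
      omega))
  exact ⟨this.1, i, hi.1, hi.2, this.2⟩

/-- naturals prime to `p` have valuation zero -/
lemma w_nat_coprime {p : ℕ} (hp : p.Prime) (wp : V.Ge 1 (p : L)) {b : ℕ} (hb : ¬ p ∣ b) :
    (b : L) ≠ 0 ∧ V.w (b : L) = 0 := by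
  have hc : IsCoprime (p : ℤ) (b : ℤ) := by
    rw [Nat.isCoprime_iff_coprime]; exact (Nat.Prime.coprime_iff_not_dvd hp).mpr hb
  obtain ⟨x, y, hxy⟩ := hc
  have h1 : (y : L) * b = 1 + -((x : L) * p) := by
    have := congrArg (Int.cast : ℤ → L) hxy
    push_cast at this
    linear_combination this
  have h2 := V.eq_add (m := 0) (y := -((x : L) * p)) one_ne_zero V.w_one
    (V.ge_neg (by simpa using V.ge_mul (V.ge_int x) wp))
  rw [← h1] at h2
  have hy : (y : L) ≠ 0 := fun h => h2.1 (by rw [h, zero_mul])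
  have hb' : (b : L) ≠ 0 := fun h => h2.1 (by rw [h, mul_zero])
  refine ⟨hb', ?_⟩
  rw [V.mul' _ _ hy hb'] at h2
  have := V.le_w hy (V.ge_int y)
  have := V.le_w hb' (V.ge_nat b)
  omega
end DV

end

/-! ### Part 2 -/

section
open Module


structure RS (p : ℕ) (K L : Type) [Field K] [Field L] [Algebra K L] (V : DV L) (t : L) : Prop where
  hp : p.Prime
  inv : ∀ (g : L ≃ₐ[K] L) (x : L), V.w (g x) = V.w x
  t0 : t ≠ 0
  wt : V.w t = 1
  wp : V.Ge 1 (p : L)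
  res : ∀ u : L, V.Ge 0 u → ∃ c : K, V.Ge 1 (u - algebraMap K L c)
  tot : ∀ c : K, c ≠ 0 → (finrank K L : ℤ) ∣ V.w (algebraMap K L c)

namespace RS
variable {p : ℕ} {K L : Type} [Field K] [Field L] [Algebra K L] {V : DV L} {t : L}

lemma ge_map (S : RS p K L V t) {m : ℤ} {x : L} (g : L ≃ₐ[K] L) (h : V.Ge m x) :
    V.Ge m (g x) := by
  rcases h with h | h
  · left; rw [h, map_zero]
  · right; rw [S.inv]; exact h

lemma ge_t (S : RS p K L V t) : V.Ge 1 t := Or.inr S.wt.ge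

lemma R0 (S : RS p K L V t) (g : L ≃ₐ[K] L) {m : ℤ} (hm : V.Ge m (g t - t)) :
    ∀ u : L, V.Ge 0 u → V.Ge m (g u - u) := by
  have key : ∀ N : ℕ, (N : ℤ) ≤ m → ∀ u : L, V.Ge 0 u → V.Ge N (g u - u) := by
    intro N
    induction N with
    | zero => intro _ u hu; exact V.ge_sub (S.ge_map g hu) hu
    | succ N ih =>
      intro hN u hu
      push_cast at hN ⊢
      obtain ⟨c, hc⟩ := S.res u hu
      set u' := (u - algebraMap K L c) / t with hu'
      have h0 : V.Ge 0 u' := by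
        have := V.ge_div S.t0 hc
        rwa [S.wt] at this
      have e : u = algebraMap K L c + t * u' := by
        rw [hu']; have := S.t0; field_simp; ring
      have e2 : g u - u = (g t - t) * g u' + t * (g u' - u') := by
        rw [e]; simp only [map_add, map_mul, AlgEquiv.commutes]; ring
      rw [e2]
      refine V.ge_add (V.ge_mono (by omega) (V.ge_mul hm (S.ge_map g h0))) ?_
      rw [add_comm (N : ℤ)]
      exact V.ge_mul S.ge_t (ih (by omega) u' h0)
  intro u hu
  by_cases h : 0 ≤ m
  · have := key m.toNat (by omega) u hu
    rwa [Int.toNat_of_nonneg h] at this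
  · exact V.ge_mono (by omega) (V.ge_sub (S.ge_map g hu) hu)

lemma ge_one_gt (S : RS p K L V t) (g : L ≃ₐ[K] L) : V.Ge 1 (g t - t) :=
  V.ge_sub (S.ge_map g S.ge_t) S.ge_t

lemma eq_one (S : RS p K L V t) {g : L ≃ₐ[K] L} (h : g t = t) : g = 1 := by
  have h1 : ∀ u, V.Ge 0 u → g u = u := fun u hu => by
    have := V.eq_zero_of_ge (x := g u - u) fun m => S.R0 g (by rw [h, sub_self]; exact V.ge_zero _) u hu
    exact sub_eq_zero.mp this
  ext x
  by_cases hx : x = 0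
  · simp [hx]
  rcases le_total 0 (V.w x) with h2 | h2
  · exact h1 x (Or.inr h2)
  · have := h1 x⁻¹ (Or.inr (by rw [V.w_inv hx]; omega))
    rw [map_inv₀] at this
    simpa using inv_injective this

lemma gt_sub_ne (S : RS p K L V t) {g : L ≃ₐ[K] L} (h : g ≠ 1) : g t - t ≠ 0 :=
  fun h' => h (S.eq_one (sub_eq_zero.mp h'))

/-- powers of `t` -/
lemma powE (S : RS p K L V t) (g : L ≃ₐ[K] L) {m : ℤ} (hm : 1 ≤ m) (hz : V.Ge m (g t - t)) (k : ℕ) :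
    V.Ge (m + k) (t * (g t ^ k - t ^ k)) := by
  induction k with
  | zero => simpa using V.ge_zero _
  | succ k ih =>
    have e : t * (g t ^ (k+1) - t ^ (k+1)) = t * (t * (g t ^ k - t ^ k))
        + (g t - t) * (t * (g t ^ k - t ^ k)) + (g t - t) * t ^ (k+1) := by ring
    rw [e]
    push_cast
    refine V.ge_add (V.ge_add ?_ ?_) ?_
    · exact V.ge_mono (by omega) (V.ge_mul S.ge_t ih)
    · exact V.ge_mono (by omega) (V.ge_mul hz ih)
    · refine V.ge_mul hz (Or.inr ?_)
      rw [V.w_pow S.t0, S.wt]; push_cast; omega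

lemma powE' (S : RS p K L V t) (g : L ≃ₐ[K] L) {m : ℤ} (hm : 2 ≤ m) (hz : V.Ge m (g t - t)) (k : ℕ) :
    V.Ge (m + k + 1) (t * (g t ^ k - t ^ k) - k * (g t - t) * t ^ k) := by
  induction k with
  | zero => simpa using V.ge_zero _
  | succ k ih =>
    have e : t * (g t ^ (k+1) - t ^ (k+1)) - ((k + 1 : ℕ) : L) * (g t - t) * t ^ (k+1)
      = t * (t * (g t ^ k - t ^ k) - k * (g t - t) * t ^ k)
        + (g t - t) * (t * (g t ^ k - t ^ k)) := by push_cast; ring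
    rw [e]
    push_cast
    refine V.ge_add ?_ ?_
    · exact V.ge_mono (by omega) (V.ge_mul S.ge_t ih)
    · exact V.ge_mono (by omega) (V.ge_mul hz (S.powE g (by omega) hz k))

lemma decomp (S : RS p K L V t) {x : L} (hx : x ≠ 0) {k : ℕ} (hk : V.w x = k) :
    ∃ u, u ≠ 0 ∧ V.w u = 0 ∧ x = u * t ^ k := by
  have htk : t ^ k ≠ 0 := pow_ne_zero _ S.t0
  refine ⟨x / t ^ k, div_ne_zero hx htk, ?_, (div_mul_cancel₀ _ htk).symm⟩
  rw [V.w_div hx htk, V.w_pow S.t0, S.wt, hk]; ring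

lemma R1 (S : RS p K L V t) (g : L ≃ₐ[K] L) {m : ℤ} (hm : V.Ge m (g t - t)) {x : L}
    (hx : V.Ge 0 x) : V.Ge (V.w x + m - 1) (g x - x) := by
  wlog h1 : 1 ≤ m generalizing m
  · exact V.ge_mono (by omega) (this (S.ge_one_gt g) le_rfl)
  by_cases hx0 : x = 0
  · subst hx0; simpa using V.ge_zero _
  obtain ⟨k, hk⟩ := Int.eq_ofNat_of_zero_le (V.le_w hx0 hx)
  obtain ⟨u, hu, hwu, rfl⟩ := S.decomp hx0 hk
  rw [hk]
  have e : g (u * t ^ k) - u * t ^ k = (g u - u) * g (t ^ k) + u * (t * (g t ^ k - t ^ k)) / t := by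
    have := S.t0
    simp only [map_mul, map_pow]; field_simp; ring
  rw [e]
  have hwk : V.w (t ^ k) = k := by rw [V.w_pow S.t0, S.wt]; ring
  refine V.ge_add ?_ ?_
  · refine V.ge_mono ?_ (V.ge_mul (S.R0 g hm u (Or.inr hwu.ge)) (S.ge_map g (V.ge_self (t ^ k))))
    omega
  · refine V.ge_mono ?_ (V.ge_div S.t0 (V.ge_mul (V.ge_self u) (S.powE g h1 hm k)))
    rw [S.wt]; omega

lemma R2 (S : RS p K L V t) (g : L ≃ₐ[K] L) (hg : g ≠ 1) (hm : 2 ≤ V.w (g t - t)) {x : L} (hx0 : x ≠ 0)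
    {k : ℕ} (hk : V.w x = k) (hpk : ¬ p ∣ k) :
    g x - x ≠ 0 ∧ V.w (g x - x) = k + V.w (g t - t) - 1 := by
  obtain ⟨u, hu, hwu, rfl⟩ := S.decomp hx0 hk
  set m := V.w (g t - t) with hmdef
  have hz0 := S.gt_sub_ne hg
  obtain ⟨hk0, hwk⟩ := V.w_nat_coprime S.hp S.wp hpk
  have hmain : u * (k * (g t - t) * t ^ k) / t ≠ 0 :=
    div_ne_zero (mul_ne_zero hu (mul_ne_zero (mul_ne_zero hk0 hz0) (pow_ne_zero _ S.t0))) S.t0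
  have hwmain : V.w (u * (k * (g t - t) * t ^ k) / t) = k + m - 1 := by
    rw [V.w_div (mul_ne_zero hu (mul_ne_zero (mul_ne_zero hk0 hz0) (pow_ne_zero _ S.t0))) S.t0,
      V.mul' _ _ hu (mul_ne_zero (mul_ne_zero hk0 hz0) (pow_ne_zero _ S.t0)),
      V.mul' _ _ (mul_ne_zero hk0 hz0) (pow_ne_zero _ S.t0), V.mul' _ _ hk0 hz0, V.w_pow S.t0, S.wt,
      hwu, hwk, ← hmdef]; ring
  have e : g (u * t ^ k) - u * t ^ k = u * (k * (g t - t) * t ^ k) / t +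
      ((g u - u) * g (t ^ k) + u * (t * (g t ^ k - t ^ k) - k * (g t - t) * t ^ k) / t) := by
    have := S.t0
    simp only [map_mul, map_pow]; field_simp; ring
  rw [e]
  refine V.eq_add hmain hwmain (V.ge_add ?_ ?_)
  · have hwk : V.w (t ^ k) = k := by rw [V.w_pow S.t0, S.wt]; ring
    refine V.ge_mono ?_ (V.ge_mul (S.R0 g (V.ge_self _) u (Or.inr hwu.ge)) (S.ge_map g (V.ge_self (t ^ k))))
    omega
  · refine V.ge_mono ?_ (V.ge_div S.t0 (V.ge_mul (V.ge_self u) (S.powE' g hm (V.ge_self _) k)))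
    rw [S.wt]; omega

lemma R3 (S : RS p K L V t) (g : L ≃ₐ[K] L) {m : ℤ} (hm : 2 ≤ m) (hz : V.Ge m (g t - t)) (b : ℕ) :
    V.Ge (m + 1) ((g ^ b) t - t - b * (g t - t)) := by
  induction b with
  | zero => simpa using V.ge_zero _
  | succ b ih =>
    have e : (g ^ (b+1)) t - t - ((b+1 : ℕ) : L) * (g t - t)
        = g ((g ^ b) t - t - b * (g t - t)) + b * (g (g t - t) - (g t - t)) := by
      rw [pow_succ', AlgEquiv.mul_apply]
      simp only [map_sub, map_mul, map_natCast]; push_cast; ring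
    rw [e]
    refine V.ge_add (S.ge_map g ih) ?_
    by_cases h0 : g t - t = 0
    · rw [h0]; simpa using V.ge_zero _
    have h1 := V.le_w h0 hz
    refine V.ge_mono ?_ (V.ge_mul (V.ge_nat b) (S.R1 g hz (Or.inr (by omega))))
    omega

lemma R3_ge (S : RS p K L V t) (g : L ≃ₐ[K] L) {m : ℤ} (hm : 2 ≤ m) (hz : V.Ge m (g t - t)) (b : ℕ) :
    V.Ge m ((g ^ b) t - t) := by
  have := V.ge_add (V.ge_mono (by omega) (S.R3 g hm hz b)) (V.ge_mono (k := m) (by omega) (V.ge_mul (V.ge_nat b) hz))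
  simpa using this

lemma R3_eq (S : RS p K L V t) (g : L ≃ₐ[K] L) (hg : g ≠ 1) (hm : 2 ≤ V.w (g t - t)) {b : ℕ} (hb : ¬ p ∣ b) :
    (g ^ b) t - t ≠ 0 ∧ V.w ((g ^ b) t - t) = V.w (g t - t) := by
  obtain ⟨hk0, hwk⟩ := V.w_nat_coprime S.hp S.wp hb
  have hz0 := S.gt_sub_ne hg
  have := V.eq_add (m := V.w (g t - t)) (mul_ne_zero hk0 hz0) (by rw [V.mul' _ _ hk0 hz0, hwk, zero_add])
    (S.R3 g hm (V.ge_self _) b)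
  simpa using this

/-- the elements `x_k` -/
lemma exists_xk (S : RS p K L V t) (g : L ≃ₐ[K] L) (k : ℕ) (hgk : g ^ k ≠ 1) :
    ∃ x : L, g x - x ≠ 0 ∧ V.w (g x - x) = k + V.w ((g ^ k) t - t) - 1 := by
  have hne : ∀ j : ℕ, (g ^ j) t ≠ 0 := fun j => (map_ne_zero _).mpr S.t0
  set x := ∏ j ∈ Finset.range k, (g ^ j) t with hx
  have hx0 : x ≠ 0 := Finset.prod_ne_zero_iff.mpr fun j _ => hne j
  have hwx : V.w x = k := by
    rw [hx, V.w_prod _ _ fun j _ => hne j]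
    simp only [S.inv, S.wt]; simp
  have hgx : g x * t = x * (g ^ k) t := by
    have h1 : g x = ∏ j ∈ Finset.range k, (g ^ (j+1)) t := by
      rw [hx, map_prod]
      refine Finset.prod_congr rfl fun j _ => ?_
      rw [pow_succ', AlgEquiv.mul_apply]
    have h2 := Finset.prod_range_succ' (fun j => (g ^ j) t) k
    rw [Finset.prod_range_succ] at h2
    rw [pow_zero, AlgEquiv.one_apply] at h2
    rw [h1]; exact h2.symm
  have e : g x - x = x * ((g ^ k) t - t) / t := by
    have := S.t0
    field_simp; linear_combination hgx
  have hz := S.gt_sub_ne hgk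
  refine ⟨x, ?_, ?_⟩
  · rw [e]; exact div_ne_zero (mul_ne_zero hx0 hz) S.t0
  · rw [e, V.w_div (mul_ne_zero hx0 hz) S.t0, V.mul' _ _ hx0 hz, hwx, S.wt]
end RS

end

/-! ### Part 3 -/

section
open Module

namespace RS
variable {p : ℕ} {K L : Type} [Field K] [Field L] [Algebra K L] {V : DV L} {t : L}

open Classical in
noncomputable def dd (H : Subgroup (L ≃ₐ[K] L)) [Fintype H] (t : L) : L :=
  ∏ h ∈ (Finset.univ : Finset H).erase 1, (t - (h : L ≃ₐ[K] L) t)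

lemma dd_ne (S : RS p K L V t) (H : Subgroup (L ≃ₐ[K] L)) [Fintype H] : dd H t ≠ 0 := by
  classical
  unfold dd
  refine Finset.prod_ne_zero_iff.mpr fun h hh => ?_
  have : (h : L ≃ₐ[K] L) ≠ 1 := fun h' => (Finset.mem_erase.mp hh).1 (Subtype.ext h')
  have := S.gt_sub_ne this
  intro h0; apply this; linear_combination -h0

lemma euler (S : RS p K L V t) (H : Subgroup (L ≃ₐ[K] L)) [Fintype H] (i : ℕ)
    (hi : i < Fintype.card H) :
    ∑ h : H, (h : L ≃ₐ[K] L) (t ^ i / dd H t) = if i = Fintype.card H - 1 then 1 else 0 := by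
  classical
  have hinj : Set.InjOn (fun h : H => (h : L ≃ₐ[K] L) t) (Finset.univ : Finset H) := by
    intro a _ b _ hab
    have hab' : (a : L ≃ₐ[K] L) t = (b : L ≃ₐ[K] L) t := hab
    have : ((b : L ≃ₐ[K] L)⁻¹ * a) t = t := by
      rw [AlgEquiv.mul_apply, hab', ← AlgEquiv.mul_apply, inv_mul_cancel, AlgEquiv.one_apply]
    have := S.eq_one this
    exact Subtype.ext (inv_mul_eq_one.mp this).symm
  have key := Lagrange.coeff_eq_sum hinj (P := (Polynomial.X ^ i : Polynomial L)) (by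
    rw [Polynomial.degree_X_pow, Finset.card_univ]; exact_mod_cast hi)
  rw [Polynomial.coeff_X_pow, Finset.card_univ] at key
  have e1 : (if i = Fintype.card H - 1 then (1 : L) else 0) = if Fintype.card H - 1 = i then 1 else 0 := by
    simp only [eq_comm]
  rw [e1, key]
  refine Finset.sum_congr rfl fun h _ => ?_
  rw [map_div₀, map_pow, Polynomial.eval_pow, Polynomial.eval_X]
  congr 1
  rw [dd, map_prod]
  refine Finset.prod_bij' (fun k _ => h * k) (fun k _ => h⁻¹ * k) ?_ ?_ ?_ ?_ ?_
  · intro a ha; simp only [Finset.mem_erase, Finset.mem_univ, and_true] at ha ⊢; simpa using ha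
  · intro a ha; simp only [Finset.mem_erase, Finset.mem_univ, and_true] at ha ⊢
    intro h'; exact ha (inv_mul_eq_one.mp h').symm
  · intro a _; simp
  · intro a _; simp
  · intro a _; simp

variable [FiniteDimensional K L] [IsGalois K L]

lemma tot_sub (S : RS p K L V t) (H : Subgroup (L ≃ₐ[K] L)) [Fintype H]
    (c : IntermediateField.fixedField H) (hc : c ≠ 0) : (Fintype.card H : ℤ) ∣ V.w (c : L) := by
  have hc' : (c : L) ≠ 0 := by simpa using hc
  have h1 : Algebra.norm K (c : L) = (Algebra.norm K c) ^ (Fintype.card H) := by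
    have := Algebra.norm_norm (R := K) (S := IntermediateField.fixedField H) (A := L) (a := (c : L))
    rw [← this]
    have h2 : Algebra.norm (IntermediateField.fixedField H) (c : L) = c ^ finrank (IntermediateField.fixedField H) L :=
      Algebra.norm_algebraMap c
    rw [h2, IntermediateField.finrank_fixedField_eq_card, map_pow, Nat.card_eq_fintype_card]
  have h3 := Algebra.norm_eq_prod_automorphisms K (c : L)
  have h4 : V.w (algebraMap K L (Algebra.norm K (c : L))) = finrank K L * V.w (c : L) := by
    rw [h3, V.w_prod _ _ fun g _ => (map_ne_zero _).mpr hc']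
    simp only [S.inv]
    rw [Finset.sum_const, Finset.card_univ, ← Nat.card_eq_fintype_card, IsGalois.card_aut_eq_finrank]
    simp
  have hn0 : Algebra.norm K c ≠ 0 := Algebra.norm_ne_zero_iff.mpr hc
  have hn0' : algebraMap K L (Algebra.norm K c) ≠ 0 := (map_ne_zero _).mpr hn0
  rw [h1, map_pow, V.w_pow hn0'] at h4
  obtain ⟨z, hz⟩ := S.tot _ hn0
  rw [hz] at h4
  have : (finrank K L : ℤ) ≠ 0 := by exact_mod_cast (finrank_pos (R := K) (M := L)).ne'
  refine ⟨z, ?_⟩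
  apply mul_left_cancel₀ this
  linarith

lemma trace_ne (S : RS p K L V t) (H : Subgroup (L ≃ₐ[K] L)) [Fintype H] (y : L) (hy : y ≠ 0)
    (hw : (Fintype.card H : ℤ) ∣ V.w y + V.w (dd H t) + 1) :
    ∑ h : H, (h : L ≃ₐ[K] L) y ≠ 0 := by
  classical
  set F := IntermediateField.fixedField H with hF
  set Q := Fintype.card H with hQ
  have hQ0 : 0 < Q := Fintype.card_pos
  have hterm : ∀ (c : F) (i : ℕ), c ≠ 0 → ∃ z : ℤ, V.w ((c : L) * t ^ i) = Q * z + i := by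
    intro c i hc
    obtain ⟨z, hz⟩ := S.tot_sub H c hc
    refine ⟨z, ?_⟩
    rw [V.mul' _ _ (by simpa using hc) (pow_ne_zero _ S.t0), hz, V.w_pow S.t0, S.wt]; ring
  have hdist : ∀ c : Fin Q → F, ∀ i ∈ (Finset.univ : Finset (Fin Q)), ∀ j ∈ (Finset.univ : Finset (Fin Q)),
      (c i : L) * t ^ (i : ℕ) ≠ 0 → (c j : L) * t ^ (j : ℕ) ≠ 0 →
      V.w ((c i : L) * t ^ (i : ℕ)) = V.w ((c j : L) * t ^ (j : ℕ)) → i = j := by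
    intro c i _ j _ hi hj hij
    obtain ⟨a, ha⟩ := hterm (c i) i (fun h => hi (by rw [h]; simp))
    obtain ⟨b, hb⟩ := hterm (c j) j (fun h => hj (by rw [h]; simp))
    rw [ha, hb] at hij
    have h1 : ((i : ℕ) : ℤ) % Q = ((j : ℕ) : ℤ) % Q := by
      have : ((i : ℕ) : ℤ) = (j : ℕ) + Q * (b - a) := by linarith
      rw [this, Int.add_mul_emod_self_left]
    rw [Int.emod_eq_of_lt (by omega) (by exact_mod_cast i.2),
      Int.emod_eq_of_lt (by omega) (by exact_mod_cast j.2)] at h1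
    exact Fin.ext (by exact_mod_cast h1)
  have hli : LinearIndependent F (fun i : Fin Q => t ^ (i : ℕ)) := by
    rw [Fintype.linearIndependent_iff]
    intro c hc
    by_contra hne
    push Not at hne
    obtain ⟨i, hi⟩ := hne
    have := (V.sum_distinct Finset.univ (fun i => (c i : L) * t ^ (i : ℕ)) (hdist c)
      ⟨i, Finset.mem_univ _, mul_ne_zero (by simpa using hi) (pow_ne_zero _ S.t0)⟩).1
    apply this
    rw [← hc]
    rfl
  have hspan := hli.span_eq_top_of_card_eq_finrank' (by
    rw [Fintype.card_fin, IntermediateField.finrank_fixedField_eq_card, Nat.card_eq_fintype_card])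
  have hd := S.dd_ne H
  obtain ⟨c, hc⟩ := (Submodule.mem_span_range_iff_exists_fun F).mp
    (hspan ▸ Submodule.mem_top : y * dd H t ∈ _)
  have hc' : ∑ i : Fin Q, (c i : L) * t ^ (i : ℕ) = y * dd H t := by
    rw [← hc]; rfl
  have hydd := mul_ne_zero hy hd
  have hex : ∃ i ∈ (Finset.univ : Finset (Fin Q)), (c i : L) * t ^ (i : ℕ) ≠ 0 := by
    by_contra hne
    push Not at hne
    exact hydd (by rw [← hc']; exact Finset.sum_eq_zero hne)
  obtain ⟨-, i, -, hi0, hi⟩ := V.sum_distinct Finset.univ _ (hdist c) hex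
  rw [hc', V.mul' _ _ hy hd] at hi
  have hci : c i ≠ 0 := fun h => hi0 (by rw [h]; simp)
  obtain ⟨z, hz⟩ := hterm (c i) i hci
  have hiQ : (i : ℕ) = Q - 1 := by
    rw [hi, hz] at hw
    have h2 : (Q : ℤ) ∣ (i : ℕ) + 1 := by
      have : ((i : ℕ) : ℤ) + 1 = (Q * z + (i : ℕ) + 1) - Q * z := by ring
      rw [this]; exact dvd_sub hw (dvd_mul_right _ _)
    have h3 : Q ∣ (i : ℕ) + 1 := by exact_mod_cast h2
    have := Nat.le_of_dvd (by omega) h3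
    have := i.2
    omega
  have hfix : ∀ (h : H) (a : F), (h : L ≃ₐ[K] L) (a : L) = a := fun h a => a.2 h
  have htr : ∑ h : H, (h : L ≃ₐ[K] L) y = c i := by
    have e : y = ∑ j : Fin Q, (c j : L) * (t ^ (j : ℕ) / dd H t) := by
      rw [eq_comm, ← mul_div_cancel_right₀ y hd, ← hc', Finset.sum_div]
      exact Finset.sum_congr rfl fun j _ => by ring
    calc ∑ h : H, (h : L ≃ₐ[K] L) y
        = ∑ h : H, ∑ j : Fin Q, (c j : L) * (h : L ≃ₐ[K] L) (t ^ (j : ℕ) / dd H t) := by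
          refine Finset.sum_congr rfl fun h _ => ?_
          conv_lhs => rw [e]
          rw [map_sum]
          exact Finset.sum_congr rfl fun j _ => by rw [map_mul, hfix]
      _ = ∑ j : Fin Q, (c j : L) * (if (j : ℕ) = Q - 1 then 1 else 0) := by
          rw [Finset.sum_comm]
          refine Finset.sum_congr rfl fun j _ => ?_
          rw [← Finset.mul_sum, S.euler H j j.2]
      _ = c i := by
          rw [Finset.sum_eq_single i]
          · rw [if_pos hiQ, mul_one]
          · intro j _ hj
            rw [if_neg (fun h => hj (Fin.ext (h.trans hiQ.symm))), mul_zero]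
          · simp
  rw [htr]
  simpa using hci
end RS

end

/-! ### Part 4 -/

section
open Module

namespace Arith
noncomputable def SS (p : ℕ) (I : ℕ → ℤ) (N : ℕ) : ℤ :=
  ∑ k ∈ Finset.range (p ^ N), if k = 0 then 0 else I (padicValNat p k)

lemma SS_zero (p : ℕ) (I : ℕ → ℤ) : SS p I 0 = 0 := by simp [SS]

lemma sum_blocks (p M : ℕ) (F : ℕ → ℤ) :
    ∑ k ∈ Finset.range (p * M), F k = ∑ j ∈ Finset.range M, ∑ i ∈ Finset.range p, F (p * j + i) := by
  induction M with
  | zero => simp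
  | succ M ih => rw [Nat.mul_succ, Finset.sum_range_add, ih, Finset.sum_range_succ]

lemma SS_succ {p : ℕ} (hp : p.Prime) (I : ℕ → ℤ) (N : ℕ) :
    SS p I (N + 1) = SS p (fun m => I (m + 1)) N + p ^ N * (p - 1) * I 0 := by
  have := Fact.mk hp
  have h1 : ∀ j, ∑ i ∈ Finset.range p, (if p * j + i = 0 then 0 else I (padicValNat p (p * j + i)))
      = (if j = 0 then 0 else I (padicValNat p j + 1)) + (p - 1) * I 0 := by
    intro j
    obtain ⟨q, hq⟩ : ∃ q, p = q + 1 := ⟨p - 1, by have := hp.pos; omega⟩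
    have : ∀ i ∈ Finset.range q, (if p * j + (i + 1) = 0 then 0 else I (padicValNat p (p * j + (i + 1)))) = I 0 := by
      intro i hi
      rw [if_neg (by omega), padicValNat.eq_zero_of_not_dvd]
      rw [Nat.dvd_add_right (dvd_mul_right _ _)]
      intro h
      have := Nat.le_of_dvd (by omega) h
      have := Finset.mem_range.mp hi
      omega
    rw [show Finset.range p = Finset.range (q + 1) by rw [hq], Finset.sum_range_succ', Finset.sum_congr rfl this]
    rw [Finset.sum_const, Finset.card_range, add_comm]
    congr 1
    · by_cases hj : j = 0
      · simp [hj]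
      · rw [if_neg hj, if_neg (by simp [hj, hp.ne_zero]), add_zero, padicValNat.mul hp.ne_zero hj,
          padicValNat_self, add_comm]
    · rw [hq]; simp
  rw [SS, pow_succ', sum_blocks, Finset.sum_congr rfl (fun j _ => h1 j), Finset.sum_add_distrib]
  rw [SS]; simp; ring

lemma SS_succ' {p : ℕ} (hp : p.Prime) (I : ℕ → ℤ) (N : ℕ) :
    SS p I (N + 1) = p * SS p I N + (p - 1) * I N := by
  induction N generalizing I with
  | zero => rw [SS_succ hp, SS_zero, SS_zero]; simp
  | succ N ih => rw [SS_succ hp, ih, SS_succ hp I N]; ring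

lemma B_dvd {p : ℕ} (hp : p.Prime) (I : ℕ → ℤ) (c : ℕ) (hc : c ≤ 1) (N : ℕ)
    (h : ∀ m, m < N → (p : ℤ) ^ (m + c) ∣ I (m + 1) - I m) :
    (p : ℤ) ^ (N + c) ∣ SS p I (N + 1) + I N := by
  induction N with
  | zero =>
    rw [SS_succ' hp, SS_zero]
    have : (p : ℤ) * 0 + (p - 1) * I 0 + I 0 = p * I 0 := by ring
    rw [this]
    interval_cases c
    · simp
    · simp
  | succ N ih =>
    have h1 := ih fun m hm => h m (by omega)
    have h2 := h N (by omega)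
    rw [SS_succ' hp I (N+1)]
    have : (p : ℤ) * SS p I (N + 1) + (p - 1) * I (N + 1) + I (N + 1)
      = p * ((SS p I (N + 1) + I N) + (I (N + 1) - I N)) := by ring
    rw [this, show N + 1 + c = (N + c) + 1 by ring, pow_succ']
    exact mul_dvd_mul_left _ (dvd_add h1 h2)
lemma tele {p : ℕ} (I : ℕ → ℤ) (m N : ℕ) (hmN : m ≤ N)
    (h : ∀ j, m ≤ j → j < N → (p : ℤ) ^ m ∣ I (j + 1) - I j) : (p : ℤ) ^ m ∣ I N - I m := by
  induction N, hmN using Nat.le_induction with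
  | base => simp
  | succ N hN ih =>
    have h1 := ih fun j h1 h2 => h j h1 (by omega)
    have h2 := h N hN (by omega)
    have : I (N+1) - I m = (I (N+1) - I N) + (I N - I m) := by ring
    rw [this]; exact dvd_add h2 h1
end Arith

namespace RS
variable {p : ℕ} {K L : Type} [Field K] [Field L] [Algebra K L] {V : DV L} {t : L}

lemma two_le (S : RS p K L V t) (σ : L ≃ₐ[K] L) (hm : 2 ≤ V.w (σ t - t)) (k : ℕ) (hk : σ ^ k ≠ 1) :
    2 ≤ V.w ((σ ^ k) t - t) :=
  V.le_w (S.gt_sub_ne hk) (S.R3_ge σ le_rfl (Or.inr hm) k)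

lemma w_pow_eq (S : RS p K L V t) (σ : L ≃ₐ[K] L) (hm : 2 ≤ V.w (σ t - t)) (k : ℕ) (hk : σ ^ k ≠ 1) :
    V.w ((σ ^ k) t - t) = V.w ((σ ^ (p ^ (padicValNat p k))) t - t) := by
  have := Fact.mk S.hp
  have hk0 : k ≠ 0 := by rintro rfl; simp at hk
  obtain ⟨b, hb, hkb⟩ : ∃ b, ¬ p ∣ b ∧ k = p ^ (padicValNat p k) * b := by
    refine ⟨k / p ^ (padicValNat p k), ?_, (Nat.mul_div_cancel' pow_padicValNat_dvd).symm⟩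
    have := Nat.not_dvd_ordCompl S.hp hk0
    rwa [Nat.factorization_def _ S.hp] at this
  have h1 : σ ^ k = (σ ^ (p ^ (padicValNat p k))) ^ b := by rw [← pow_mul, ← hkb]
  have hne : σ ^ (p ^ (padicValNat p k)) ≠ 1 := by
    intro h; apply hk; rw [h1, h, one_pow]
  rw [h1]
  exact (S.R3_eq _ hne (S.two_le σ hm _ hne) hb).2

def II (V : DV L) (t : L) (p : ℕ) (σ : L ≃ₐ[K] L) (m : ℕ) : ℤ := V.w ((σ ^ (p ^ m)) t - t) - 1

lemma sum_zpowers {M : Type*} [AddCommMonoid M] (σ : L ≃ₐ[K] L) [Fintype (Subgroup.zpowers σ)] (F : (L ≃ₐ[K] L) → M)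
    (hfin : IsOfFinOrder σ) :
    ∑ h : Subgroup.zpowers σ, F h = ∑ k ∈ Finset.range (orderOf σ), F (σ ^ k) := by
  rw [← Fin.sum_univ_eq_sum_range (fun k => F (σ ^ k))]
  exact (Fintype.sum_equiv (finEquivZPowers hfin) _ _ (fun k => by rw [finEquivZPowers_apply])).symm

lemma w_dd (S : RS p K L V t) (H : Subgroup (L ≃ₐ[K] L)) [Fintype H] :
    V.w (dd H t) = ∑ h : H, (open Classical in if (h : L ≃ₐ[K] L) = 1 then 0 else V.w ((h : L ≃ₐ[K] L) t - t)) := by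
  classical
  unfold dd
  have hne : ∀ h ∈ (Finset.univ : Finset H).erase 1, (h : L ≃ₐ[K] L) ≠ 1 := fun h hh h' =>
    (Finset.mem_erase.mp hh).1 (Subtype.ext h')
  rw [V.w_prod]
  · rw [← Finset.sum_erase (s := (Finset.univ : Finset H)) (a := 1) (h := by simp)]
    refine Finset.sum_congr rfl fun h hh => ?_
    rw [if_neg (hne h hh), ← V.w_neg _ (S.gt_sub_ne (hne h hh))]
    congr 1; ring
  · intro h hh
    have := S.gt_sub_ne (hne h hh)
    intro h0; apply this; linear_combination -h0

lemma w_dd_zpowers (S : RS p K L V t) (σ : L ≃ₐ[K] L) (hm : 2 ≤ V.w (σ t - t)) (N : ℕ)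
    (ho : orderOf σ = p ^ N) [Fintype (Subgroup.zpowers σ)] :
    V.w (dd (Subgroup.zpowers σ) t) + 1 = Arith.SS p (II V t p σ) N + p ^ N := by
  classical
  have hfin : IsOfFinOrder σ := orderOf_pos_iff.mp (by rw [ho]; exact pow_pos S.hp.pos _)
  rw [S.w_dd]
  rw [sum_zpowers σ (fun h => if h = 1 then 0 else V.w (h t - t)) hfin, ho, Arith.SS]
  obtain ⟨q, hq⟩ : ∃ q, p ^ N = q + 1 := ⟨p ^ N - 1, by have := pow_pos S.hp.pos N; omega⟩
  have hq' : (p : ℤ) ^ N = q + 1 := by exact_mod_cast hq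
  rw [hq, hq', Finset.sum_range_succ', Finset.sum_range_succ']
  have : ∀ k ∈ Finset.range q, (if σ ^ (k + 1) = 1 then 0 else V.w ((σ ^ (k+1)) t - t))
      = (if k + 1 = 0 then 0 else II V t p σ (padicValNat p (k + 1))) + 1 := by
    intro k hk
    have hk' := Finset.mem_range.mp hk
    have hne : σ ^ (k + 1) ≠ 1 := by
      intro h
      have := Nat.le_of_dvd (by omega) (orderOf_dvd_of_pow_eq_one h)
      omega
    rw [if_neg hne, if_neg (by omega), II, S.w_pow_eq σ hm _ hne]; ring
  rw [Finset.sum_congr rfl this, Finset.sum_add_distrib]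
  simp; ring

variable [FiniteDimensional K L] [IsGalois K L]

theorem hasseArf (S : RS p K L V t) (N : ℕ) : ∀ (σ : L ≃ₐ[K] L), 2 ≤ V.w (σ t - t) →
    orderOf σ = p ^ N → ∀ m, m + 1 < N → (p : ℤ) ^ (m + 1) ∣ II V t p σ (m + 1) - II V t p σ m := by
  classical
  have := Fact.mk S.hp
  induction N with
  | zero => intro _ _ _ m hm; omega
  | succ N ih =>
    intro σ hσ ho m hm
    by_contra hnd
    have hop : orderOf (σ ^ p) = p ^ N := by
      rw [orderOf_pow' _ S.hp.ne_zero, ho, Nat.gcd_eq_right (dvd_pow_self _ (by omega)), pow_succ,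
        Nat.mul_div_cancel _ S.hp.pos]
    have hp1 : σ ^ p ≠ 1 := by
      intro h
      rw [h, orderOf_one] at hop
      have := Nat.one_lt_pow (n := N) (by omega) S.hp.one_lt
      omega
    have hII : ∀ j, II V t p (σ ^ p) j = II V t p σ (j + 1) := by
      intro j; unfold II; rw [← pow_mul, ← pow_succ']
    have weak : ∀ j, j < N → (p : ℤ) ^ (j + 0) ∣ II V t p σ (j + 1) - II V t p σ j := by
      intro j hj
      rcases j with _ | j
      · simp
      · have := ih (σ ^ p) (S.two_le σ hσ p hp1) hop j (by omega)
        rwa [hII, hII] at this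
    set I := II V t p σ with hI
    have hB := Arith.B_dvd S.hp I 0 (by omega) N weak
    have hpp : (0 : ℤ) < (p : ℤ) ^ (N + 1) := pow_pos (by exact_mod_cast S.hp.pos) _
    haveI : Fintype (Subgroup.zpowers σ) := Fintype.ofFinite _
    have hdd := S.w_dd_zpowers σ hσ (N + 1) ho
    obtain ⟨k, hk⟩ := Int.eq_ofNat_of_zero_le
      (Int.emod_nonneg (I N - (Arith.SS p I (N+1) + I N) - I m) hpp.ne')
    have hkQ : (p : ℤ) ^ (N+1) ∣ k - (I N - (Arith.SS p I (N+1) + I N) - I m) := by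
      rw [← hk]; exact ⟨_, by rw [Int.emod_def, sub_sub_cancel_left, ← mul_neg]⟩
    have hkltZ := Int.emod_lt_of_pos (I N - (Arith.SS p I (N+1) + I N) - I m) hpp
    rw [hk] at hkltZ
    have hklt : k < p ^ (N+1) := by exact_mod_cast hkltZ
    have hmod : (p : ℤ) ^ (m + 1) ∣ k - (I (m+1) - I m) := by
      have h1 : (p : ℤ) ^ (m+1) ∣ k - (I N - (Arith.SS p I (N+1) + I N) - I m) :=
        (pow_dvd_pow _ (by omega)).trans hkQ
      have h2 : (p : ℤ) ^ (m+1) ∣ (Arith.SS p I (N+1) + I N) :=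
        (pow_dvd_pow _ (by omega)).trans hB
      have h3 : (p : ℤ) ^ (m+1) ∣ I N - I (m + 1) := Arith.tele I (m+1) N (by omega)
        fun j hj hj' => (pow_dvd_pow _ (by omega)).trans (weak j hj')
      have : (k : ℤ) - (I (m+1) - I m) = (k - (I N - (Arith.SS p I (N+1) + I N) - I m))
        - (Arith.SS p I (N+1) + I N) + (I N - I (m + 1)) := by ring
      rw [this]; exact dvd_add (dvd_sub h1 h2) h3
    have hnk : ¬ p ^ (m+1) ∣ k := by
      intro h
      apply hnd
      have h' : (p : ℤ) ^ (m+1) ∣ k := by exact_mod_cast h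
      exact (dvd_sub_right h').mp hmod
    have hyk : p ^ m ∣ k := by
      have h1 : (p : ℤ) ^ m ∣ k - (I (m+1) - I m) := (pow_dvd_pow _ (by omega)).trans hmod
      have h2 := weak m (by omega)
      rw [add_zero] at h2
      have : (p : ℤ) ^ m ∣ k := by
        have := dvd_add h1 h2; simpa using this
      exact_mod_cast this
    have hk0 : k ≠ 0 := by rintro rfl; exact hnk (dvd_zero _)
    have hval : padicValNat p k = m := by
      have h1 := (padicValNat_dvd_iff_le hk0 (n := m)).mp hyk
      have h2 := mt (padicValNat_dvd_iff_le hk0 (n := m+1)).mpr hnk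
      omega
    have hσk : σ ^ k ≠ 1 := by
      intro h
      have := Nat.le_of_dvd (by omega) (orderOf_dvd_of_pow_eq_one h)
      omega
    obtain ⟨x, hx0, hx⟩ := S.exists_xk σ k hσk
    rw [S.w_pow_eq σ hσ k hσk, hval] at hx
    have hx' : V.w (σ x - x) = k + I m := by rw [hx, hI, II]; ring
    refine S.trace_ne (Subgroup.zpowers σ) _ hx0 ?_ ?_
    · rw [← Nat.card_eq_fintype_card, Nat.card_zpowers, ho, hx', add_assoc, hdd]
      push_cast
      have : (k : ℤ) + I m + (Arith.SS p I (N+1) + (p:ℤ) ^ (N+1))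
        = (k - (I N - (Arith.SS p I (N+1) + I N) - I m)) + (p:ℤ) ^ (N+1) := by ring
      rw [this]; exact dvd_add hkQ dvd_rfl
    · simp only [map_sub]
      rw [Finset.sum_sub_distrib, sub_eq_zero]
      refine Fintype.sum_equiv (Equiv.mulRight ⟨σ, Subgroup.mem_zpowers σ⟩) _ _ fun h => ?_
      simp

theorem B_dvd (S : RS p K L V t) (N : ℕ) (σ : L ≃ₐ[K] L) (hσ : 2 ≤ V.w (σ t - t))
    (ho : orderOf σ = p ^ (N+1)) : (p : ℤ) ^ (N + 1) ∣ Arith.SS p (II V t p σ) (N + 1) + II V t p σ N :=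
  Arith.B_dvd S.hp _ 1 le_rfl N fun m hm => S.hasseArf (N+1) σ hσ ho m (by omega)
end RS

end

/-! ### Part 5 -/

section
open Module

namespace DV
variable {L : Type} [Field L] (V : DV L)
def O : Subring L where
  carrier := {x | V.Ge 0 x}
  mul_mem' ha hb := by simpa using V.ge_mul ha hb
  one_mem' := V.ge_one
  add_mem' ha hb := V.ge_add ha hb
  zero_mem' := V.ge_zero 0
  neg_mem' ha := V.ge_neg ha
def M : Ideal V.O where
  carrier := {x | V.Ge 1 (x : L)}
  add_mem' ha hb := V.ge_add ha hb
  zero_mem' := V.ge_zero 1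
  smul_mem' c x hx := by simpa using V.ge_mul c.2 hx
lemma mem_M (x : V.O) : x ∈ V.M ↔ V.Ge 1 (x : L) := Iff.rfl
lemma not_ge_one_one : ¬ V.Ge 1 (1 : L) := by
  intro h; have := V.le_w one_ne_zero h; rw [V.w_one] at this; omega
instance M_prime : V.M.IsPrime where
  ne_top' := by
    rw [Ne, Ideal.eq_top_iff_one, mem_M]; exact V.not_ge_one_one
  mem_or_mem' := by
    intro x y hxy
    simp only [mem_M] at *
    by_contra! h
    have hx0 : (x : L) ≠ 0 := fun h0 => h.1 (h0 ▸ V.ge_zero 1)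
    have hy0 : (y : L) ≠ 0 := fun h0 => h.2 (h0 ▸ V.ge_zero 1)
    have h1 : ¬ 1 ≤ V.w (x : L) := fun h' => h.1 (Or.inr h')
    have h2 : ¬ 1 ≤ V.w (y : L) := fun h' => h.2 (Or.inr h')
    have := V.le_w (mul_ne_zero hx0 hy0) hxy
    rw [V.mul' _ _ hx0 hy0] at this
    have := V.le_w hx0 x.2
    have := V.le_w hy0 y.2
    omega
end DV

namespace RS
variable {p : ℕ} {K L : Type} [Field K] [Field L] [Algebra K L] {V : DV L} {t : L}

lemma om_ge (S : RS p K L V t) (g : L ≃ₐ[K] L) : V.Ge 0 (g t / t) := by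
  have := V.ge_div S.t0 (S.ge_map g S.ge_t)
  rwa [S.wt] at this

noncomputable def zeta (S : RS p K L V t) : (L ≃ₐ[K] L) →* (V.O ⧸ V.M) where
  toFun g := Ideal.Quotient.mk _ ⟨g t / t, S.om_ge g⟩
  map_one' := by
    have : (⟨(1 : L ≃ₐ[K] L) t / t, S.om_ge 1⟩ : V.O) = 1 := Subtype.ext (by simp [S.t0])
    rw [this, map_one]
  map_mul' g h := by
    rw [← map_mul, Ideal.Quotient.eq, DV.mem_M]
    have e : (g * h) t / t - g t / t * (h t / t) = (g (h t / t) - h t / t) * (g t / t) := by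
      rw [map_div₀, AlgEquiv.mul_apply]
      have : g t ≠ 0 := (map_ne_zero _).mpr S.t0
      have := S.t0
      field_simp
    have := V.ge_mul (S.R0 g (S.ge_one_gt g) _ (S.om_ge h)) (S.om_ge g)
    rw [add_zero, ← e] at this
    exact this

lemma zeta_one (S : RS p K L V t) (g : L ≃ₐ[K] L) : S.zeta g = 1 ↔ V.Ge 2 (g t - t) := by
  have : S.zeta g = 1 ↔ V.Ge 1 (g t / t - 1) := by
    have h1 : S.zeta g = Ideal.Quotient.mk _ ⟨g t / t, S.om_ge g⟩ := rfl
    rw [h1, ← map_one (Ideal.Quotient.mk V.M), Ideal.Quotient.eq, DV.mem_M]; rfl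
  rw [this]
  have e : g t / t - 1 = (g t - t) / t := by field_simp [S.t0]
  have e' : g t - t = (g t / t - 1) * t := by field_simp [S.t0]
  constructor
  · intro h; rw [e']; exact V.ge_mul h S.ge_t
  · intro h; rw [e]; have := V.ge_div S.t0 h; rwa [S.wt] at this

lemma zeta_pow (S : RS p K L V t) (σ g : L ≃ₐ[K] L) (hc : σ * g = g * σ) (hσ : σ ≠ 1) (i : ℕ)
    (hi : V.w (σ t - t) = i + 1) : S.zeta g ^ i = 1 := by
  have ht := S.t0
  set ω := g t / t with hω
  set a := (σ t - t) / t with ha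
  have hz := S.gt_sub_ne hσ
  have ha0 : a ≠ 0 := div_ne_zero hz ht
  have hwa : V.w a = i := by rw [ha, V.w_div hz ht, hi, S.wt]; ring
  have hgt : g t = ω * t := by rw [hω]; field_simp
  have hσt : σ t = t * (1 + a) := by rw [ha]; field_simp; ring
  have hcomm : σ (g t) = g (σ t) := by
    rw [← AlgEquiv.mul_apply, hc, AlgEquiv.mul_apply]
  have e1 : ω * (1 + g a) = σ ω * (1 + a) := by
    have h1 : g (σ t) = ω * t * (1 + g a) := by rw [hσt]; simp [hgt]
    have h2 : σ (g t) = σ ω * (t * (1 + a)) := by rw [hgt, map_mul, hσt]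
    rw [h1, h2] at hcomm
    apply mul_right_cancel₀ ht
    linear_combination -hcomm
  have e2 : ω * (g a - a) = (σ ω - ω) * (1 + a) := by linear_combination e1
  have hω0 : ω ≠ 0 := div_ne_zero ((map_ne_zero _).mpr ht) ht
  have hwω : V.w ω = 0 := by rw [hω, V.w_div ((map_ne_zero _).mpr ht) ht, S.inv]; ring
  have h3 : V.Ge (i + 1) (σ ω - ω) := S.R0 σ (by rw [← hi]; exact V.ge_self _) ω (S.om_ge g)
  have hage : V.Ge 0 a := Or.inr (by rw [hwa]; positivity)
  have h4 : V.Ge (i + 1) (g a - a) := by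
    have h5 := V.ge_div hω0 (V.ge_mul h3 (V.ge_add V.ge_one hage))
    rw [← e2, mul_div_cancel_left₀ _ hω0, hwω] at h5
    simpa using h5
  obtain ⟨u, hu0, hwu, hau⟩ := S.decomp ha0 hwa
  have e3 : g a - a = t ^ i * (g u * ω ^ i - u) := by
    rw [hau, map_mul, map_pow, hgt]; ring
  have h5 : V.Ge 1 (g u * ω ^ i - u) := by
    have := V.ge_div (pow_ne_zero i ht) h4
    rw [e3, mul_div_cancel_left₀ _ (pow_ne_zero i ht), V.w_pow ht, S.wt] at this
    simpa using this
  have hu : V.Ge 0 u := Or.inr hwu.ge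
  have h6 : V.Ge 1 (u * (ω ^ i - 1)) := by
    have e : u * (ω ^ i - 1) = (g u * ω ^ i - u) - (g u - u) * ω ^ i := by ring
    rw [e]
    refine V.ge_sub h5 ?_
    have := V.ge_mul (S.R0 g (S.ge_one_gt g) u hu) (V.ge_pow (S.om_ge g) i)
    simpa using this
  have h7 : V.Ge 1 (ω ^ i - 1) := by
    have := V.ge_div hu0 h6
    rw [mul_div_cancel_left₀ _ hu0, hwu] at this
    simpa using this
  have h1 : S.zeta g = Ideal.Quotient.mk _ ⟨g t / t, S.om_ge g⟩ := rfl
  rw [h1, ← map_pow, ← map_one (Ideal.Quotient.mk V.M), Ideal.Quotient.eq, DV.mem_M]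
  exact h7

lemma zeta_ppow (S : RS p K L V t) (x : V.O ⧸ V.M) (N : ℕ) (h : x ^ (p ^ N) = 1) : x = 1 := by
  have := Fact.mk S.hp
  have hp0 : (p : V.O ⧸ V.M) = 0 := by
    rw [← map_natCast (Ideal.Quotient.mk V.M), Ideal.Quotient.eq_zero_iff_mem, DV.mem_M]
    simpa using S.wp
  have : CharP (V.O ⧸ V.M) p := by
    obtain ⟨q, hq⟩ := CharP.exists (V.O ⧸ V.M)
    have h1 := (CharP.cast_eq_zero_iff (V.O ⧸ V.M) q p).mp hp0
    rcases (Nat.dvd_prime S.hp).mp h1 with h2 | h2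
    · subst h2; exact absurd rfl (CharP.char_ne_one (V.O ⧸ V.M) 1)
    · exact h2 ▸ hq
  have h1 : (x - 1) ^ (p ^ N) = 0 := by rw [sub_pow_char_pow, h]; simp
  exact sub_eq_zero.mp (pow_eq_zero_iff (pow_ne_zero _ S.hp.ne_zero) |>.mp h1)

variable [FiniteDimensional K L] [IsGalois K L]

lemma two_le_of_ppow (S : RS p K L V t) (σ : L ≃ₐ[K] L) (N : ℕ) (h : σ ^ (p ^ N) = 1) (h1 : σ ≠ 1) :
    2 ≤ V.w (σ t - t) := by
  refine V.le_w (S.gt_sub_ne h1) ((S.zeta_one σ).mp (S.zeta_ppow _ N ?_))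
  rw [← map_pow, h, map_one]

lemma ker_zeta (S : RS p K L V t) (hab : ∀ σ τ : L ≃ₐ[K] L, σ * τ = τ * σ) (γ : L ≃ₐ[K] L) (N : ℕ)
    (ho : orderOf γ = p ^ N) (hc : finrank K L = (p - 1) * p ^ N) (g : L ≃ₐ[K] L)
    (hg : S.zeta g = 1) : g ∈ Subgroup.zpowers γ := by
  have hcard : Nat.card (L ≃ₐ[K] L) = (p - 1) * p ^ N := by rw [IsGalois.card_aut_eq_finrank, hc]
  have hpn : ¬ p ∣ (p - 1) := fun h => by
    have := Nat.le_of_dvd (by have := S.hp.two_le; omega) h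
    have := S.hp.two_le; omega
  have h1 : g ^ (p ^ N) = 1 := by
    by_contra hne
    have hW : 2 ≤ V.w ((g ^ (p ^ N)) t - t) := by
      refine V.le_w (S.gt_sub_ne hne) ((S.zeta_one _).mp ?_)
      rw [map_pow, hg, one_pow]
    have := (S.R3_eq _ hne hW hpn).1
    apply this
    rw [← pow_mul, mul_comm, ← hcard, pow_card_eq_one']
    simp
  have hnormal : (Subgroup.zpowers γ).Normal := ⟨fun x hx y => by
    rw [hab y x, mul_assoc, mul_inv_cancel, mul_one]; exact hx⟩
  have hidx : (Subgroup.zpowers γ).index = p - 1 := by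
    have := (Subgroup.zpowers γ).card_mul_index
    rw [Nat.card_zpowers, ho, hcard, mul_comm] at this
    exact Nat.eq_of_mul_eq_mul_right (pow_pos S.hp.pos N) this
  have h2 := Subgroup.pow_index_mem (Subgroup.zpowers γ) g
  rw [hidx] at h2
  have hcop : IsCoprime ((p - 1 : ℕ) : ℤ) ((p ^ N : ℕ) : ℤ) := by
    rw [Nat.isCoprime_iff_coprime]
    exact (Nat.Coprime.pow_left N ((Nat.Prime.coprime_iff_not_dvd S.hp).mpr hpn)).symm
  obtain ⟨a, b, hab'⟩ := hcop
  have : g = (g ^ (p - 1)) ^ a * (g ^ (p ^ N)) ^ b := by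
    rw [← zpow_natCast, ← zpow_natCast, ← zpow_mul, ← zpow_mul, ← zpow_add, mul_comm _ a, mul_comm _ b, hab', zpow_one]
  rw [this, h1, one_zpow, mul_one]
  exact Subgroup.zpow_mem _ h2 _

theorem tame (S : RS p K L V t) (hab : ∀ σ τ : L ≃ₐ[K] L, σ * τ = τ * σ) (γ : L ≃ₐ[K] L) (N : ℕ)
    (ho : orderOf γ = p ^ (N+1)) (hc : finrank K L = (p - 1) * p ^ (N+1)) :
    2 ≤ V.w (γ t - t) ∧ (∀ g : L ≃ₐ[K] L, g ∉ Subgroup.zpowers γ → V.w (g t - t) = 1) ∧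
    ∀ m ≤ N, ((p - 1 : ℕ) : ℤ) ∣ II V t p γ m := by
  classical
  have hp2 := S.hp.two_le
  have hcard : Nat.card (L ≃ₐ[K] L) = (p - 1) * p ^ (N+1) := by rw [IsGalois.card_aut_eq_finrank, hc]
  have hγ1 : γ ≠ 1 := by
    rintro rfl
    rw [orderOf_one] at ho
    have := Nat.one_lt_pow (n := N + 1) (by omega) S.hp.one_lt
    omega
  have hγ2 := S.two_le_of_ppow γ (N+1) (by rw [← ho, pow_orderOf_eq_one]) hγ1
  refine ⟨hγ2, ?_, ?_⟩
  · intro g hg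
    have hg1 : g ≠ 1 := by rintro rfl; exact hg (one_mem _)
    have h1 := V.le_w (S.gt_sub_ne hg1) (S.ge_one_gt g)
    by_contra hne
    exact hg (S.ker_zeta hab γ (N+1) ho hc g ((S.zeta_one g).mpr (Or.inr (by omega))))
  · intro m hm
    have hne : γ ^ (p ^ m) ≠ 1 := by
      intro h
      have h1 := orderOf_dvd_of_pow_eq_one h
      rw [ho, Nat.pow_dvd_pow_iff_le_right S.hp.one_lt] at h1
      omega
    have h2 := S.two_le γ hγ2 _ hne
    obtain ⟨i, hi⟩ := Int.eq_ofNat_of_zero_le (a := II V t p γ m) (by unfold II; omega)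
    have hi' : V.w ((γ ^ (p ^ m)) t - t) = i + 1 := by rw [← hi, II]; ring
    rw [hi]
    have hz1 : ∀ g, S.zeta g ^ i = 1 := fun g => S.zeta_pow _ g (hab _ _) hne i hi'
    have hz2 : ∀ g, S.zeta g ^ (p - 1) = 1 := fun g => by
      refine S.zeta_ppow _ (N+1) ?_
      rw [← map_pow, ← map_pow, ← pow_mul, ← hcard, pow_card_eq_one', map_one]
    set d := Nat.gcd i (p - 1) with hd
    have hd0 : 0 < d := Nat.gcd_pos_of_pos_right _ (by omega)
    have hz : ∀ g, S.zeta g ^ d = 1 := fun g => orderOf_dvd_iff_pow_eq_one.mp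
      (Nat.dvd_gcd (orderOf_dvd_of_pow_eq_one (hz1 g)) (orderOf_dvd_of_pow_eq_one (hz2 g)))
    have hle : (p - 1) ≤ d := by
      have h1 : Fintype.card (L ≃ₐ[K] L) ≤ p ^ (N+1) * (Finset.univ.image S.zeta).card := by
        rw [← Finset.card_univ]
        refine Finset.card_le_mul_card_image _ _ fun b _ => ?_
        by_cases hb : ∃ g, S.zeta g = b
        · obtain ⟨g, rfl⟩ := hb
          rw [← ho, ← Nat.card_zpowers, Nat.card_eq_fintype_card, ← Finset.card_univ]
          refine Finset.card_le_card_of_injOn (fun h => if hh : h * g⁻¹ ∈ Subgroup.zpowers γ then ⟨h * g⁻¹, hh⟩ else 1) (fun _ _ => Finset.mem_coe.mpr (Finset.mem_univ _)) ?_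
          have hmem : ∀ h ∈ (Finset.univ.filter fun h => S.zeta h = S.zeta g), h * g⁻¹ ∈ Subgroup.zpowers γ := by
            intro h hh
            refine S.ker_zeta hab γ (N+1) ho hc _ ?_
            rw [map_mul, (Finset.mem_filter.mp hh).2, ← map_mul, mul_inv_cancel, map_one]
          intro x hx y hy hxy
          simp only [dif_pos (hmem x hx), dif_pos (hmem y hy), Subtype.mk.injEq] at hxy
          exact mul_right_cancel hxy
        · rw [Finset.filter_eq_empty_iff.mpr fun g _ h => hb ⟨g, h⟩]; simp
      have h2 : (Finset.univ.image S.zeta).card ≤ d := by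
        refine le_trans ?_ (Polynomial.card_nthRoots d (1 : V.O ⧸ V.M))
        refine le_trans (Finset.card_le_card ?_) (Multiset.toFinset_card_le _)
        intro z hz'
        obtain ⟨g, -, rfl⟩ := Finset.mem_image.mp hz'
        rw [Multiset.mem_toFinset, Polynomial.mem_nthRoots hd0]
        exact hz g
      rw [← Nat.card_eq_fintype_card, hcard, mul_comm] at h1
      exact (Nat.le_of_mul_le_mul_left h1 (pow_pos S.hp.pos _)).trans h2
    have : d = p - 1 := le_antisymm (Nat.le_of_dvd (by omega) (Nat.gcd_dvd_right _ _)) hle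
    have h3 : d ∣ i := Nat.gcd_dvd_left i (p - 1)
    rw [this] at h3
    exact_mod_cast h3
end RS

end

/-! ### Part 6 -/

section
open Module

namespace RS
variable {p : ℕ} {K L : Type} [Field K] [Field L] [Algebra K L] {V : DV L} {t : L}
variable [FiniteDimensional K L] [IsGalois K L]

lemma sum_ram (S : RS p K L V t) (hab : ∀ σ τ : L ≃ₐ[K] L, σ * τ = τ * σ) (γ : L ≃ₐ[K] L) (N : ℕ)
    (ho : orderOf γ = p ^ (N+1)) (hc : finrank K L = (p - 1) * p ^ (N+1)) :
    ∑ g : L ≃ₐ[K] L, (open Classical in if g = 1 then 0 else V.w (g t - t) - 1)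
      = Arith.SS p (II V t p γ) (N+1) := by
  classical
  obtain ⟨h2, hout, -⟩ := S.tame hab γ N ho hc
  have h1 : ∑ g : L ≃ₐ[K] L, (if g = 1 then 0 else V.w (g t - t) - 1)
      = ∑ h : Subgroup.zpowers γ, (if (h : L ≃ₐ[K] L) = 1 then 0 else V.w ((h : L ≃ₐ[K] L) t - t) - 1) := by
    rw [← Finset.sum_subtype (p := fun g => g ∈ Subgroup.zpowers γ) (Finset.univ.filter (· ∈ Subgroup.zpowers γ))
      (by simp) (fun g : L ≃ₐ[K] L => (if g = 1 then 0 else V.w (g t - t) - 1))]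
    rw [Finset.sum_filter]
    refine Finset.sum_congr rfl fun g _ => ?_
    by_cases hg : g ∈ Subgroup.zpowers γ
    · rw [if_pos hg]
    · rw [if_neg hg, hout g hg]; simp
  rw [h1]
  have h3 := S.w_dd_zpowers γ h2 (N+1) ho
  rw [S.w_dd] at h3
  have h4 : ∑ h : Subgroup.zpowers γ, (if (h : L ≃ₐ[K] L) = 1 then 0 else V.w ((h : L ≃ₐ[K] L) t - t) - 1)
      = ∑ h : Subgroup.zpowers γ, (if (h : L ≃ₐ[K] L) = 1 then 0 else V.w ((h : L ≃ₐ[K] L) t - t))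
        - ∑ h : Subgroup.zpowers γ, (if h = 1 then 0 else 1) := by
    rw [← Finset.sum_sub_distrib]
    refine Finset.sum_congr rfl fun h _ => ?_
    by_cases hh : h = 1
    · simp [hh]
    · rw [if_neg (by simpa using hh), if_neg (by simpa using hh), if_neg hh]
  have h5 : ∑ h : Subgroup.zpowers γ, (if h = 1 then (0:ℤ) else 1) = p ^ (N+1) - 1 := by
    have : ∑ h : Subgroup.zpowers γ, (if h = 1 then (0:ℤ) else 1)
      = ∑ h : Subgroup.zpowers γ, (1 - (if h = 1 then (1:ℤ) else 0)) :=
        Finset.sum_congr rfl fun h _ => by split_ifs <;> simp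
    rw [this, Finset.sum_sub_distrib]
    simp [ho, Fintype.card_zpowers]
  rw [h4, h5]
  linarith

lemma w_dd_top (S : RS p K L V t) (hab : ∀ σ τ : L ≃ₐ[K] L, σ * τ = τ * σ) (γ : L ≃ₐ[K] L) (N : ℕ)
    (ho : orderOf γ = p ^ (N+1)) (hc : finrank K L = (p - 1) * p ^ (N+1)) [Fintype (⊤ : Subgroup (L ≃ₐ[K] L))] :
    V.w (dd (⊤ : Subgroup (L ≃ₐ[K] L)) t) + 1 = Arith.SS p (II V t p γ) (N+1) + finrank K L := by
  classical
  rw [S.w_dd, ← S.sum_ram hab γ N ho hc]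
  have h1 : ∑ h : (⊤ : Subgroup (L ≃ₐ[K] L)), (if (h : L ≃ₐ[K] L) = 1 then 0 else V.w ((h : L ≃ₐ[K] L) t - t))
     = ∑ g : L ≃ₐ[K] L, (if g = 1 then 0 else V.w (g t - t)) :=
    Fintype.sum_equiv Subgroup.topEquiv.toEquiv _ _ fun h => rfl
  rw [h1]
  have h4 : ∑ g : L ≃ₐ[K] L, (if g = 1 then 0 else V.w (g t - t) - 1)
      = ∑ g : L ≃ₐ[K] L, (if g = 1 then 0 else V.w (g t - t))
        - ∑ g : L ≃ₐ[K] L, (1 - (if g = 1 then (1:ℤ) else 0)) := by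
    rw [← Finset.sum_sub_distrib]
    refine Finset.sum_congr rfl fun h _ => ?_
    split_ifs <;> simp
  rw [h4, Finset.sum_sub_distrib]
  simp [← Nat.card_eq_fintype_card, IsGalois.card_aut_eq_finrank]
  ring

lemma phi_dvd (S : RS p K L V t) (hab : ∀ σ τ : L ≃ₐ[K] L, σ * τ = τ * σ) (γ : L ≃ₐ[K] L) (N : ℕ)
    (ho : orderOf γ = p ^ (N+1)) (hc : finrank K L = (p - 1) * p ^ (N+1)) :
    (finrank K L : ℤ) ∣ Arith.SS p (II V t p γ) (N+1) + II V t p γ N := by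
  have := Fact.mk S.hp
  obtain ⟨h2, hout, hI⟩ := S.tame hab γ N ho hc
  have hpn : ¬ p ∣ (p - 1) := fun h => by
    have := Nat.le_of_dvd (by have := S.hp.two_le; omega) h
    have := S.hp.two_le; omega
  have hcop : IsCoprime ((p - 1 : ℕ) : ℤ) ((p ^ (N+1) : ℕ) : ℤ) := by
    rw [Nat.isCoprime_iff_coprime]
    exact (Nat.Coprime.pow_left _ ((Nat.Prime.coprime_iff_not_dvd S.hp).mpr hpn)).symm
  rw [hc]
  push_cast only [Nat.cast_mul]
  refine hcop.mul_dvd ?_ ?_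
  · refine dvd_add (Finset.dvd_sum fun k hk => ?_) (hI N le_rfl)
    split_ifs with h0
    · exact dvd_zero _
    · refine hI _ ?_
      have h3 : p ^ padicValNat p k ≤ k := Nat.le_of_dvd (by omega) pow_padicValNat_dvd
      have h4 := h3.trans_lt (Finset.mem_range.mp hk)
      have := (Nat.pow_lt_pow_iff_right S.hp.one_lt).mp h4
      omega
  · have := S.B_dvd N γ h2 ho
    exact_mod_cast this

theorem core (S : RS p K L V t) (hab : ∀ σ τ : L ≃ₐ[K] L, σ * τ = τ * σ) (γ : L ≃ₐ[K] L) (N : ℕ)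
    (ho : orderOf γ = p ^ (N+1)) (hc : finrank K L = (p - 1) * p ^ (N+1))
    (hp0 : (p : L) ≠ 0) (hwp : V.w (p : L) = finrank K L)
    (hphi : Arith.SS p (II V t p γ) (N+1) + II V t p γ N < (N + 2) * finrank K L)
    (a : K) (ha : V.Ge 0 (algebraMap K L a)) (x : L) (hx0 : x ≠ 0) (hx1 : 1 ≤ V.w x) (hxp : V.w x < p) :
    ∃ β : L, V.Ge 0 β ∧ ∑ i ∈ Finset.range (p ^ N), Algebra.trace K L ((γ ^ i) (algebraMap K L a + x) * β)
      = (p : K) ^ (N+1) := by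
  classical
  obtain ⟨h2, hout, hI⟩ := S.tame hab γ N ho hc
  set e : ℤ := (finrank K L : ℤ) with he
  have he0 : 0 < e := by rw [he]; exact_mod_cast finrank_pos (R := K) (M := L)
  have hphi' : Arith.SS p (II V t p γ) (N+1) + II V t p γ N ≤ (N + 1) * e := by
    obtain ⟨z, hz⟩ := S.phi_dvd hab γ N ho hc
    rw [hz] at hphi ⊢
    have : z < N + 2 := by
      rw [mul_comm] at hphi; exact lt_of_mul_lt_mul_right hphi he0.le
    nlinarith
  have hi0 : (p : ℤ) - 1 ≤ V.w (γ t - t) - 1 := by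
    have h3 := hI 0 (Nat.zero_le _)
    have h4 : II V t p γ 0 = V.w (γ t - t) - 1 := by simp [II]
    rw [h4] at h3
    have := Int.le_of_dvd (by omega) h3
    have := S.hp.two_le
    omega
  set α := algebraMap K L a + x with hα
  set y := ∑ i ∈ Finset.range (p ^ N), (γ ^ i) α with hy
  have hne : γ ^ (p ^ N) ≠ 1 := by
    intro h
    have h1 := orderOf_dvd_of_pow_eq_one h
    rw [ho, Nat.pow_dvd_pow_iff_le_right S.hp.one_lt] at h1
    omega
  have hyd : γ y - y = (γ ^ (p ^ N)) x - x := by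
    have h3 : γ y - y = ∑ i ∈ Finset.range (p ^ N), ((γ ^ (i+1)) α - (γ ^ i) α) := by
      rw [hy, map_sum, ← Finset.sum_sub_distrib]
      exact Finset.sum_congr rfl fun i _ => by rw [pow_succ', AlgEquiv.mul_apply]
    rw [h3, Finset.sum_range_sub (fun i => (γ ^ i) α), hα, map_add, AlgEquiv.commutes, pow_zero, AlgEquiv.one_apply]
    ring
  obtain ⟨r, hr⟩ := Int.eq_ofNat_of_zero_le (a := V.w x) (by omega)
  obtain ⟨hd0, hd⟩ := S.R2 _ hne (S.two_le γ h2 _ hne) hx0 hr (fun h => by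
    have := Nat.le_of_dvd (by omega) h; omega)
  rw [← hyd] at hd0 hd
  have hT : V.w (γ y - y) = r + II V t p γ N := by rw [hd, II]; ring
  have hy0 : y ≠ 0 := by intro h; rw [h] at hd0; simp at hd0
  have hαge : V.Ge 0 α := V.ge_add ha (Or.inr (by omega))
  have hyge : V.Ge 0 y := V.ge_sum _ _ _ fun i _ => S.ge_map _ hαge
  have hwy := V.le_w hd0 (S.R1 γ (V.ge_self _) hyge)
  rw [hT] at hwy
  have hdd0 := S.dd_ne (⊤ : Subgroup (L ≃ₐ[K] L))
  have hdd := S.w_dd_top hab γ N ho hc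
  set D := dd (⊤ : Subgroup (L ≃ₐ[K] L)) t with hD
  have hcardtop : Fintype.card (⊤ : Subgroup (L ≃ₐ[K] L)) = finrank K L := by
    rw [← Nat.card_eq_fintype_card, Subgroup.card_top, IsGalois.card_aut_eq_finrank]
  have hfr : 0 < finrank K L := finrank_pos
  set β := (p : L) ^ (N+1) * (t ^ (finrank K L - 1) / D) / y with hβ
  have htd0 : t ^ (finrank K L - 1) / D ≠ 0 := div_ne_zero (pow_ne_zero _ S.t0) hdd0
  refine ⟨β, Or.inr ?_, ?_⟩
  · rw [hβ, V.w_div (mul_ne_zero (pow_ne_zero _ hp0) htd0) hy0, V.mul' _ _ (pow_ne_zero _ hp0) htd0,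
      V.w_div (pow_ne_zero _ S.t0) hdd0, V.w_pow hp0, V.w_pow S.t0, hwp, S.wt]
    push_cast [Nat.cast_sub hfr]
    have : V.w D = Arith.SS p (II V t p γ) (N+1) + e - 1 := by linarith
    rw [this]
    linarith
  · rw [← map_sum, ← Finset.sum_mul, ← hy, hβ, mul_div_cancel₀ _ hy0]
    apply (algebraMap K L).injective
    have e1 : (p : L) ^ (N+1) * (t ^ (finrank K L - 1) / D) = ((p : K) ^ (N+1)) • (t ^ (finrank K L - 1) / D) := by
      rw [Algebra.smul_def]; simp
    rw [e1, map_smul, smul_eq_mul, map_mul, trace_eq_sum_automorphisms]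
    have h5 := S.euler (⊤ : Subgroup (L ≃ₐ[K] L)) (finrank K L - 1) (by omega)
    rw [if_pos (by omega)] at h5
    have h6 : ∑ g : L ≃ₐ[K] L, g (t ^ (finrank K L - 1) / D) = 1 := by
      rw [← h5]
      exact (Fintype.sum_equiv Subgroup.topEquiv.toEquiv _ _ fun h => rfl).symm
    rw [h6, mul_one]
end RS

end

/-! ### Part 7 -/

section
open Module

namespace Herb
variable (c : ℤ → ℕ)

noncomputable def phi (u : ℝ) : ℝ := ∫ t in (0:ℝ)..u, (c ⌈t⌉ : ℝ) / (c 0 : ℝ)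

variable {c} (hc : Antitone c) (h1 : ∀ i, 1 ≤ c i)
include hc h1

lemma anti : Antitone (fun t : ℝ => (c ⌈t⌉ : ℝ) / (c 0 : ℝ)) := by
  intro a b hab
  have := hc (Int.ceil_mono hab)
  have : (c ⌈b⌉ : ℝ) ≤ c ⌈a⌉ := by exact_mod_cast this
  show (c ⌈b⌉ : ℝ) / (c 0 : ℝ) ≤ (c ⌈a⌉ : ℝ) / (c 0 : ℝ)
  gcongr

lemma integrable (a b : ℝ) : IntervalIntegrable (fun t : ℝ => (c ⌈t⌉ : ℝ) / (c 0 : ℝ)) MeasureTheory.volume a b :=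
  (anti hc h1).intervalIntegrable

lemma phi_sub {a b : ℝ} (hab : a ≤ b) : (b - a) * (1 / (c 0 : ℝ)) ≤ phi c b - phi c a := by
  unfold phi
  rw [intervalIntegral.integral_interval_sub_left (integrable hc h1 _ _) (integrable hc h1 _ _)]
  have := intervalIntegral.integral_mono_on hab (f := fun _ => 1 / (c 0 : ℝ)) (g := fun t : ℝ => (c ⌈t⌉ : ℝ) / (c 0 : ℝ))
    (by simp) (integrable hc h1 _ _) (fun t _ => by
      have : (1 : ℝ) ≤ c ⌈t⌉ := by exact_mod_cast h1 _
      show 1 / (c 0 : ℝ) ≤ (c ⌈t⌉ : ℝ) / (c 0 : ℝ)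
      gcongr)
  rw [intervalIntegral.integral_const, smul_eq_mul] at this
  exact this

lemma pos0 : (0:ℝ) < 1 / (c 0 : ℝ) := by
  have : (0 : ℝ) < c 0 := by exact_mod_cast h1 0
  positivity

lemma strictMono : StrictMono (phi c) := by
  intro a b hab
  have := phi_sub hc h1 hab.le
  have h0 := pos0 hc h1
  have : 0 < (b - a) * (1 / (c 0 : ℝ)) := mul_pos (by linarith) h0
  linarith

omit hc h1 in
lemma phi_zero : phi c 0 = 0 := by simp [phi]

lemma surj : Function.Surjective (phi c) := by
  have h0 := pos0 hc h1
  refine Continuous.surjective ?_ ?_ ?_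
  · exact intervalIntegral.continuous_primitive (fun a b => integrable hc h1 a b) 0
  · refine Filter.tendsto_atTop_mono' _ ?_ (Filter.tendsto_id.atTop_mul_const h0)
    filter_upwards [Filter.eventually_ge_atTop 0] with u hu
    have := phi_sub hc h1 hu
    rw [phi_zero] at this
    simpa using this
  · refine Filter.tendsto_atBot_mono' _ ?_ (Filter.tendsto_id.atBot_mul_const h0)
    filter_upwards [Filter.eventually_le_atBot 0] with u hu
    have := phi_sub hc h1 hu
    rw [phi_zero] at this
    simp at this ⊢
    linarith

lemma phi_psi (y : ℝ) : phi c (Function.invFun (phi c) y) = y :=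
  Function.invFun_eq (surj hc h1 y)

lemma psi_zero : Function.invFun (phi c) 0 = 0 :=
  (strictMono hc h1).injective (by rw [phi_psi hc h1, phi_zero])

lemma phi_nat (T : ℕ) : phi c T = (∑ s ∈ Finset.range T, (c (s + 1) : ℝ)) / c 0 := by
  unfold phi
  have := intervalIntegral.sum_integral_adjacent_intervals (f := fun t : ℝ => (c ⌈t⌉ : ℝ) / (c 0 : ℝ))
    (a := fun k : ℕ => (k : ℝ)) (μ := MeasureTheory.volume) (n := T) (fun k _ => integrable hc h1 _ _)
  rw [Nat.cast_zero] at this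
  rw [← this, Finset.sum_div]
  refine Finset.sum_congr rfl fun k _ => ?_
  have h2 : ∫ t in (k:ℝ)..((k+1 : ℕ) : ℝ), (c ⌈t⌉ : ℝ) / (c 0 : ℝ)
      = ∫ t in (k:ℝ)..((k+1 : ℕ) : ℝ), (c (k+1) : ℝ) / (c 0 : ℝ) := by
    refine intervalIntegral.integral_congr_ae (Filter.Eventually.of_forall fun t ht => ?_)
    rw [Set.uIoc_of_le (by push_cast; linarith)] at ht
    have : ⌈t⌉ = (k : ℤ) + 1 := by
      rw [Int.ceil_eq_iff]
      have h3 := ht.1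
      have h4 := ht.2
      push_cast at *
      constructor <;> linarith
    rw [this]
  rw [h2, intervalIntegral.integral_const]
  push_cast
  simp

/-- the final comparison -/
lemma bound (T : ℕ) (y : ℝ) (h : c ⌈Function.invFun (phi c) y⌉ < c T) :
    (∑ s ∈ Finset.range T, (c (s + 1) : ℝ)) < y * c 0 := by
  have h0 : (0 : ℝ) < c 0 := by exact_mod_cast h1 0
  have h2 : (T : ℤ) < ⌈Function.invFun (phi c) y⌉ := by
    by_contra hle
    have := hc (not_lt.mp hle)
    omega
  have h3 : ((T : ℤ) : ℝ) < Function.invFun (phi c) y := Int.lt_ceil.mp h2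
  have h4 := strictMono hc h1 h3
  rw [phi_psi hc h1, Int.cast_natCast, phi_nat hc h1, div_lt_iff₀ h0] at h4
  exact h4
end Herb

end

/-! ### Part 8 -/

section
open Module

structure Pre (p n : ℕ) (K L : Type) [Field K] [Field L] [Algebra K L] (V : DV L) : Prop where
  hp : p.Prime
  odd : p ≠ 2
  inv : ∀ (g : L ≃ₐ[K] L) (x : L), V.w (g x) = V.w x
  p0 : (p : L) ≠ 0
  wp : V.w (p : L) = finrank K L
  inert : ∀ (g : L ≃ₐ[K] L) (x : L), V.Ge 0 x → V.Ge 1 (g x - x)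
  tot : ∀ c : K, c ≠ 0 → (finrank K L : ℤ) ∣ V.w (algebraMap K L c)
  fr : finrank K L = (p - 1) * p ^ n

namespace Pre
variable {p n : ℕ} {K L : Type} [Field K] [Field L] [Algebra K L] {V : DV L}

lemma ge_map (S : Pre p n K L V) {m : ℤ} {x : L} (g : L ≃ₐ[K] L) (h : V.Ge m x) :
    V.Ge m (g x) := by
  rcases h with h | h
  · left; rw [h, map_zero]
  · right; rw [S.inv]; exact h

lemma e_pos (S : Pre p n K L V) : 0 < finrank K L := by
  rw [S.fr]; have := S.hp.two_le
  exact Nat.mul_pos (by omega) (pow_pos S.hp.pos _)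

lemma ge_p (S : Pre p n K L V) : V.Ge 1 (p : L) := by
  right; rw [S.wp]; have := S.e_pos; omega

lemma padic_sq (S : Pre p n K L V) [Fact p.Prime] (z : ℤ_[p]) : ∃ y : ℤ_[p], y ^ 2 = 1 + p * z ^ 2 := by
  have h2 : ‖(2 : ℤ_[p])‖ = 1 := by
    have : ((2 : ℕ) : ℤ_[p]) = 2 := by norm_cast
    rw [← this]
    rw [PadicInt.norm_natCast_eq_one_iff]
    rw [Nat.coprime_primes S.hp Nat.prime_two]; exact S.odd
  have := hensels_lemma (p := p) (R := ℤ_[p]) (F := Polynomial.X ^ 2 - Polynomial.C (1 + (p : ℤ_[p]) * z ^ 2)) (a := 1) (by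
    simp [Polynomial.derivative_pow]
    rw [h2]
    have hz : ‖z‖ ≤ 1 := PadicInt.norm_le_one z
    have hpp : (p : ℝ)⁻¹ < 1 := inv_lt_one_of_one_lt₀ (by exact_mod_cast S.hp.one_lt)
    have : ‖z‖ ^ 2 ≤ 1 := pow_le_one₀ (norm_nonneg _) hz
    have h0 : 0 < (p : ℝ)⁻¹ := by have := S.hp.pos; positivity
    nlinarith)
  obtain ⟨y, hy, -⟩ := this
  refine ⟨y, ?_⟩
  simp at hy
  linear_combination hy

lemma ge_padic (S : Pre p n K L V) [Fact p.Prime] (f : ℤ_[p] →+* K) (z : ℤ_[p]) :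
    V.Ge 0 (algebraMap K L (f z)) := by
  by_contra h
  have hz0 : f z ≠ 0 := by intro h0; rw [h0, map_zero] at h; exact h (V.ge_zero _)
  have hz0' : algebraMap K L (f z) ≠ 0 := (map_ne_zero _).mpr hz0
  have hneg : V.w (algebraMap K L (f z)) < 0 := by
    by_contra h'; exact h (Or.inr (not_lt.mp h'))
  obtain ⟨j, hj⟩ := S.tot _ hz0
  have he := S.e_pos
  have he' : (0 : ℤ) < finrank K L := by exact_mod_cast he
  have hjneg : j < 0 := by
    rw [hj] at hneg
    by_contra hj'
    have := mul_nonneg he'.le (not_lt.mp hj')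
    omega
  obtain ⟨y, hy⟩ := S.padic_sq z
  set Z := algebraMap K L (f z) with hZ
  have hY : (algebraMap K L (f y)) ^ 2 = p * Z ^ 2 + 1 := by
    have := congrArg (fun a => algebraMap K L (f a)) hy
    simp only [map_pow, map_add, map_mul, map_one, map_natCast] at this
    rw [this]; ring
  have h1 : V.w ((p : L) * Z ^ 2) = finrank K L * (1 + 2 * j) := by
    rw [V.mul' _ _ S.p0 (pow_ne_zero _ hz0'), S.wp, V.w_pow hz0', hj]; push_cast; ring
  have h2 := V.eq_add (mul_ne_zero S.p0 (pow_ne_zero 2 hz0')) h1 (y := 1)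
    (V.ge_mono (by nlinarith) V.ge_one)
  rw [← hY] at h2
  have hy0 : f y ≠ 0 := by intro h0; rw [h0] at h2; simp at h2
  obtain ⟨i, hi⟩ := S.tot _ hy0
  have h3 := h2.2
  rw [V.w_pow ((map_ne_zero _).mpr hy0), hi] at h3
  push_cast at h3
  have h4 : (finrank K L : ℤ) * (2 * i) = finrank K L * (1 + 2 * j) := by linarith
  have := mul_left_cancel₀ he'.ne' h4
  omega

/-- residue map -/
lemma residue_finite (S : Pre p n K L V) [Fact p.Prime] [Algebra ℚ_[p] K] [FiniteDimensional ℚ_[p] K]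
    [FiniteDimensional K L] [CharP (V.O ⧸ V.M) p]
    (x : V.O) : ∃ a b : ℕ, a < b ∧ (Ideal.Quotient.mk V.M x) ^ a = (Ideal.Quotient.mk V.M x) ^ b := by
  classical
  set f : ℤ_[p] →+* K := (algebraMap ℚ_[p] K).comp (algebraMap ℤ_[p] ℚ_[p]) with hf
  let F : ℤ_[p] →+* V.O :=
    ((algebraMap K L).comp f).codRestrict V.O (fun z => S.ge_padic f z)
  let _ : Algebra ℚ_[p] L := ((algebraMap K L).comp (algebraMap ℚ_[p] K)).toAlgebra
  have : IsScalarTower ℚ_[p] K L := IsScalarTower.of_algebraMap_eq fun _ => rfl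
  have : FiniteDimensional ℚ_[p] L := FiniteDimensional.trans ℚ_[p] K L
  let _ : Algebra ℤ_[p] L := ((algebraMap ℚ_[p] L).comp (algebraMap ℤ_[p] ℚ_[p])).toAlgebra
  have : IsScalarTower ℤ_[p] ℚ_[p] L := IsScalarTower.of_algebraMap_eq fun _ => rfl
  have halg : IsAlgebraic ℤ_[p] (x : L) :=
    (IsFractionRing.isAlgebraic_iff ℤ_[p] ℚ_[p] L).mpr (Algebra.IsAlgebraic.isAlgebraic _)
  obtain ⟨P, hP0, hP⟩ := halg
  have : FaithfulSMul ℤ_[p] L := by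
    rw [faithfulSMul_iff_algebraMap_injective]
    exact (algebraMap ℚ_[p] L).injective.comp (IsFractionRing.injective ℤ_[p] ℚ_[p])
  let _ : NormalizedGCDMonoid ℤ_[p] := Classical.choice inferInstance
  have hQ := Polynomial.aeval_primPart_eq_zero hP0 hP
  have hprim := P.isPrimitive_primPart
  set Q := P.primPart with hQdef
  let _ : Algebra (ZMod p) (V.O ⧸ V.M) := ZMod.algebra _ p
  set xb := Ideal.Quotient.mk V.M x with hxb
  have hφ : ((Ideal.Quotient.mk V.M).comp F) = (algebraMap (ZMod p) (V.O ⧸ V.M)).comp (PadicInt.toZMod) := by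
    ext z
    have h1 : z - (z.zmodRepr : ℤ_[p]) ∈ IsLocalRing.maximalIdeal ℤ_[p] := (PadicInt.sub_zmodRepr_mem z)
    rw [PadicInt.maximalIdeal_eq_span_p, Ideal.mem_span_singleton] at h1
    obtain ⟨y, hy⟩ := h1
    have hz : z = (z.zmodRepr : ℤ_[p]) + p * y := by rw [← hy]; ring
    rw [hz]
    simp [CharP.cast_eq_zero]
  have hroot : Polynomial.aeval xb (Q.map PadicInt.toZMod) = 0 := by
    rw [Polynomial.aeval_def, Polynomial.eval₂_map, ← hφ, hxb, ← Polynomial.hom_eval₂]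
    have : Polynomial.eval₂ F x Q = 0 := by
      apply Subtype.ext
      have h1 := Polynomial.hom_eval₂ Q F V.O.subtype x
      have h2 : V.O.subtype.comp F = algebraMap ℤ_[p] L := rfl
      rw [h2] at h1
      have h3 : Polynomial.eval₂ (algebraMap ℤ_[p] L) (V.O.subtype x) Q = 0 := hQ
      rw [h3] at h1
      exact h1
    rw [this, map_zero]
  have hne : Q.map (PadicInt.toZMod (p := p)) ≠ 0 := by
    intro h0
    have hdvd : Polynomial.C (p : ℤ_[p]) ∣ Q := by
      rw [Polynomial.C_dvd_iff_dvd_coeff]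
      intro i
      have h1 : PadicInt.toZMod (Q.coeff i) = 0 := by
        rw [← Polynomial.coeff_map, h0, Polynomial.coeff_zero]
      rw [← RingHom.mem_ker, PadicInt.ker_toZMod, PadicInt.maximalIdeal_eq_span_p, Ideal.mem_span_singleton] at h1
      exact h1
    have := hprim _ hdvd
    exact PadicInt.prime_p.not_isUnit this
  have hint : IsIntegral (ZMod p) xb := (IsAlgebraic.isIntegral ⟨_, hne, hroot⟩)
  have hfin : Module.Finite (ZMod p) (Algebra.adjoin (ZMod p) {xb}) :=
    Module.Finite.iff_fg.mpr hint.fg_adjoin_singleton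
  have : Finite (Algebra.adjoin (ZMod p) {xb}) := Module.finite_of_finite (ZMod p)
  obtain ⟨a, b, hab, heq⟩ := Finite.exists_ne_map_eq_of_infinite
    (fun i : ℕ => (⟨xb, Algebra.self_mem_adjoin_singleton _ _⟩ : Algebra.adjoin (ZMod p) {xb}) ^ i)
  have heq' : xb ^ a = xb ^ b := congrArg Subtype.val heq
  rcases lt_or_gt_of_ne hab with h | h
  · exact ⟨a, b, h, heq'⟩
  · exact ⟨b, a, h, heq'.symm⟩
end Pre

end

/-! ### Part 9 -/

section
open Module

namespace Pre
variable {p n : ℕ} {K L : Type} [Field K] [Field L] [Algebra K L] {V : DV L}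

lemma charP_res (S : Pre p n K L V) : CharP (V.O ⧸ V.M) p := by
  have hp0 : (p : V.O ⧸ V.M) = 0 := by
    rw [← map_natCast (Ideal.Quotient.mk V.M), Ideal.Quotient.eq_zero_iff_mem, DV.mem_M]
    simpa using S.ge_p
  obtain ⟨q, hq⟩ := CharP.exists (V.O ⧸ V.M)
  have h1 := (CharP.cast_eq_zero_iff (V.O ⧸ V.M) q p).mp hp0
  rcases (Nat.dvd_prime S.hp).mp h1 with h2 | h2
  · subst h2; exact absurd rfl (CharP.char_ne_one (V.O ⧸ V.M) 1)
  · exact h2 ▸ hq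

lemma exists_inv (S : Pre p n K L V) [Fact p.Prime] [CharP (V.O ⧸ V.M) p] (x : V.O ⧸ V.M) (hx : x ≠ 0)
    (a b : ℕ) (hab : a < b) (h : x ^ a = x ^ b) : ∃ j, x = (x ^ (p ^ n)) ^ j := by
  have h1 : x ^ (b - a) = 1 := by
    apply mul_left_cancel₀ (pow_ne_zero a hx)
    rw [← pow_add, mul_one, h]; congr 1; omega
  obtain ⟨s, m, hm, hsm⟩ := Nat.exists_eq_pow_mul_and_not_dvd (n := b - a) (by omega) p S.hp.ne_one
  rw [hsm, mul_comm, pow_mul] at h1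
  have h2 : x ^ m = 1 := by
    have : (x ^ m - 1) ^ (p ^ s) = 0 := by rw [sub_pow_char_pow, h1]; simp
    exact sub_eq_zero.mp (pow_eq_zero_iff (pow_ne_zero _ S.hp.ne_zero) |>.mp this)
  have hcop : Nat.Coprime (p ^ n) m := Nat.Coprime.pow_left n ((Nat.Prime.coprime_iff_not_dvd S.hp).mpr hm)
  obtain ⟨j, hj⟩ := exists_pow_eq_self_of_coprime (x := x)
    (Nat.Coprime.coprime_dvd_right (orderOf_dvd_of_pow_eq_one h2) hcop)
  exact ⟨j, hj.symm⟩

lemma coeff_aux {k : Type*} [CommRing k] [Nontrivial k] {p : ℕ} [Fact p.Prime] [CharP k p] (x : k) (n : ℕ) :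
    ((Polynomial.X - Polynomial.C x) ^ ((p - 1) * p ^ n)).coeff ((p - 2) * p ^ n) = x ^ (p ^ n) := by
  have hp : p.Prime := Fact.out
  have hp2 := hp.two_le
  rw [mul_comm, pow_mul, sub_pow_char_pow, ← Polynomial.C_pow]
  set b := x ^ (p ^ n) with hb
  have : ((Polynomial.X : Polynomial k) ^ (p ^ n) - Polynomial.C b) ^ (p - 1)
      = Polynomial.expand _ (p ^ n) ((Polynomial.X - Polynomial.C b) ^ (p - 1)) := by simp
  rw [this, Polynomial.coeff_expand_mul (pow_pos hp.pos n), sub_eq_add_neg, ← map_neg, Polynomial.coeff_X_add_C_pow,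
    show p - 1 - (p - 2) = 1 by omega]
  have h0 : (p : k) = 0 := CharP.cast_eq_zero _ _
  obtain ⟨q, hq⟩ : ∃ q, p = q + 2 := ⟨p - 2, by omega⟩
  have h1 : (p - 1).choose (p - 2) = q + 1 := by
    rw [hq]; exact Nat.choose_succ_self_right q
  rw [h1]
  rw [hq] at h0
  push_cast at h0 ⊢
  linear_combination (-b) * h0

variable [FiniteDimensional K L] [IsGalois K L]

lemma exists_c (S : Pre p n K L V) [Fact p.Prime] [CharP (V.O ⧸ V.M) p] (x : V.O) :
    ∃ (c : K) (hc : V.Ge 0 (algebraMap K L c)),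
      Ideal.Quotient.mk V.M ⟨algebraMap K L c, hc⟩ = (Ideal.Quotient.mk V.M x) ^ (p ^ n) := by
  classical
  have hp2 := S.hp.two_le
  set P : Polynomial V.O := ∏ g : L ≃ₐ[K] L, (Polynomial.X - Polynomial.C ⟨g (x : L), S.ge_map g x.2⟩) with hP
  have hP1 : P.map (Ideal.Quotient.mk V.M) = (Polynomial.X - Polynomial.C (Ideal.Quotient.mk V.M x)) ^ (finrank K L) := by
    have hpr : (Polynomial.X - Polynomial.C (Ideal.Quotient.mk V.M x)) ^ (finrank K L)
      = ∏ _g : L ≃ₐ[K] L, (Polynomial.X - Polynomial.C (Ideal.Quotient.mk V.M x)) := by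
      rw [Finset.prod_const, Finset.card_univ, ← Nat.card_eq_fintype_card, IsGalois.card_aut_eq_finrank]
    rw [hpr, hP, Polynomial.map_prod]
    refine Finset.prod_congr rfl fun g _ => ?_
    rw [Polynomial.map_sub, Polynomial.map_X, Polynomial.map_C]
    congr 2
    rw [Ideal.Quotient.eq, DV.mem_M]
    exact S.inert g x x.2
  set j := (p - 2) * p ^ n with hj
  have hco : (P.map (Ideal.Quotient.mk V.M)).coeff j = (Ideal.Quotient.mk V.M x) ^ (p ^ n) := by
    rw [hP1, S.fr]; exact coeff_aux _ n
  have hfix : ∀ τ : L ≃ₐ[K] L, τ (P.coeff j : L) = P.coeff j := by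
    have hL : P.map V.O.subtype = ∏ g : L ≃ₐ[K] L, (Polynomial.X - Polynomial.C (g (x : L))) := by
      rw [hP, Polynomial.map_prod]; simp
    intro τ
    have h1 : (P.coeff j : L) = (P.map V.O.subtype).coeff j := by rw [Polynomial.coeff_map]; rfl
    have h2 : (P.map V.O.subtype).map (τ : L →+* L) = P.map V.O.subtype := by
      rw [hL, Polynomial.map_prod]
      refine Fintype.prod_equiv (Equiv.mulLeft τ) _ _ fun g => ?_
      simp
    rw [h1]
    conv_rhs => rw [← h2]
    exact (Polynomial.coeff_map (p := P.map V.O.subtype) (τ : L →+* L) j).symm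
  obtain ⟨c, hc⟩ := (IsGalois.mem_range_algebraMap_iff_fixed (F := K) (E := L) (P.coeff j : L)).mpr hfix
  refine ⟨c, hc ▸ (P.coeff j).2, ?_⟩
  rw [← hco, Polynomial.coeff_map]
  congr 1
  exact Subtype.ext hc

lemma res (S : Pre p n K L V) [Fact p.Prime] [Algebra ℚ_[p] K] [FiniteDimensional ℚ_[p] K]
    (u : L) (hu : V.Ge 0 u) : ∃ c : K, V.Ge 1 (u - algebraMap K L c) := by
  have := S.charP_res
  by_cases hx : Ideal.Quotient.mk V.M ⟨u, hu⟩ = 0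
  · refine ⟨0, ?_⟩
    rw [Ideal.Quotient.eq_zero_iff_mem, DV.mem_M] at hx
    simpa using hx
  · obtain ⟨a, b, hab, h⟩ := S.residue_finite ⟨u, hu⟩
    obtain ⟨j, hj⟩ := S.exists_inv _ hx a b hab h
    obtain ⟨c, hc, hcc⟩ := S.exists_c ⟨u, hu⟩
    rw [← hcc, ← map_pow, Ideal.Quotient.eq, DV.mem_M] at hj
    refine ⟨c ^ j, ?_⟩
    rw [map_pow]
    exact hj

lemma exists_t (S : Pre p n K L V) [Fact p.Prime] [Algebra ℚ_[p] K] [FiniteDimensional ℚ_[p] K] :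
    ∃ t : L, t ≠ 0 ∧ V.w t = 1 := by
  classical
  have he := S.e_pos
  set e := finrank K L with hedef
  have hex : ∃ r : ℕ, 0 < r ∧ ∃ t : L, t ≠ 0 ∧ V.w t = r := ⟨e, he, p, S.p0, S.wp⟩
  obtain ⟨hr0, t, ht0, hwt⟩ := Nat.find_spec hex
  set r := Nat.find hex with hr
  have hmin : ∀ y : L, y ≠ 0 → 0 < V.w y → (r : ℤ) ≤ V.w y := by
    intro y hy h
    obtain ⟨k, hk⟩ := Int.eq_ofNat_of_zero_le h.le
    have := Nat.find_min' hex ⟨by omega, y, hy, hk⟩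
    omega
  have hr0' : (0 : ℤ) < r := by exact_mod_cast hr0
  have hmul : ∀ y : L, y ≠ 0 → (r : ℤ) ∣ V.w y := by
    intro y hy
    by_contra hnd
    have h1 : 0 < V.w y % r := lt_of_le_of_ne (Int.emod_nonneg _ hr0'.ne') (fun h => hnd (Int.dvd_of_emod_eq_zero h.symm))
    have h2 := Int.emod_lt_of_pos (V.w y) hr0'
    have h3 : V.w (y / t ^ (V.w y / r)) = V.w y % r := by
      rw [V.w_div hy (zpow_ne_zero _ ht0), V.w_zpow ht0, hwt, Int.emod_def]; ring
    have := hmin _ (div_ne_zero hy (zpow_ne_zero _ ht0)) (h3 ▸ h1)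
    omega
  obtain ⟨q, hq⟩ : r ∣ e := by
    have := hmul p S.p0
    rw [S.wp] at this; exact_mod_cast this
  have hq0 : 0 < q := by rcases Nat.eq_zero_or_pos q with h | h; (subst h; omega); exact h
  -- approximation
  let W : Submodule K L := Submodule.span K (Set.range fun i : Fin q => t ^ (i : ℕ))
  have happ : ∀ (j : ℕ) (m : ℤ) (z : L), V.Ge m z → ∃ s ∈ W, V.Ge (m + j) (z - s) := by
    intro j
    induction j with
    | zero => intro m z hz; exact ⟨0, W.zero_mem, by simpa using hz⟩
    | succ j ih =>
      intro m z hz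
      have : ∃ s ∈ W, V.Ge (m + 1) (z - s) := by
        by_cases hz0 : z = 0
        · exact ⟨0, W.zero_mem, by subst hz0; simpa using V.ge_zero _⟩
        obtain ⟨d, hd⟩ := hmul z hz0
        have hqz : (0 : ℤ) < q := by exact_mod_cast hq0
        obtain ⟨i, hi⟩ := Int.eq_ofNat_of_zero_le (Int.emod_nonneg d hqz.ne')
        have hilt := Int.emod_lt_of_pos d hqz
        set k := d / q with hk
        have hdk : d = q * k + i := by rw [← hi, hk]; exact (Int.mul_ediv_add_emod d q).symm
        have hiq : i < q := by omega
        have hden : (p : L) ^ k * t ^ i ≠ 0 := mul_ne_zero (zpow_ne_zero _ S.p0) (pow_ne_zero _ ht0)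
        have hwden : V.w ((p : L) ^ k * t ^ i) = V.w z := by
          rw [V.mul' _ _ (zpow_ne_zero _ S.p0) (pow_ne_zero _ ht0), V.w_zpow S.p0, V.w_pow ht0, S.wp, hwt, hd, hdk,
            ← hedef, hq]
          push_cast; ring
        have hu : V.Ge 0 (z / ((p : L) ^ k * t ^ i)) := by
          right; rw [V.w_div hz0 hden, hwden]; simp
        obtain ⟨c, hc⟩ := S.res _ hu
        refine ⟨(c * (p : K) ^ k) • t ^ i, W.smul_mem _ (Submodule.subset_span ⟨⟨i, hiq⟩, rfl⟩), ?_⟩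
        have e1 : z - (c * (p : K) ^ k) • t ^ i = (z / ((p : L) ^ k * t ^ i) - algebraMap K L c) * ((p : L) ^ k * t ^ i) := by
          rw [sub_mul, div_mul_cancel₀ _ hden, Algebra.smul_def, map_mul, map_zpow₀, map_natCast]; ring
        rw [e1]
        refine V.ge_mono ?_ (V.ge_mul hc (V.ge_self _))
        rw [hwden]
        have := V.le_w hz0 hz
        omega
      obtain ⟨s, hs, hzs⟩ := this
      obtain ⟨s', hs', hzs'⟩ := ih (m + 1) (z - s) hzs
      refine ⟨s + s', W.add_mem hs hs', ?_⟩
      rw [← sub_sub]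
      exact V.ge_mono (by push_cast; omega) hzs'
  let ev : L →ₗ[K] (Fin q → K) := LinearMap.pi fun i => (Algebra.trace K L).comp (LinearMap.mulRight K (t ^ (i : ℕ)))
  have hev : Function.Injective ev := by
    rw [injective_iff_map_eq_zero]
    intro y hy
    have hyW : ∀ s ∈ W, Algebra.trace K L (y * s) = 0 := by
      intro s hs
      have : W ≤ LinearMap.ker ((Algebra.trace K L).comp (LinearMap.mulLeft K y)) := by
        refine Submodule.span_le.mpr ?_
        rintro _ ⟨i, rfl⟩
        have := congrFun hy i
        simpa [ev] using this
      simpa using this hs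
    by_contra hy0
    have hz : ∀ z, Algebra.trace K L (y * z) = 0 := by
      intro z
      apply (algebraMap K L).injective
      rw [map_zero]
      apply V.eq_zero_of_ge
      intro M
      obtain ⟨s, hs, hzs⟩ := happ ((M - V.w z - V.w y).toNat) (V.w z) z (V.ge_self _)
      have e2 : y * z = y * s + y * (z - s) := by ring
      rw [e2, map_add, hyW s hs, zero_add, trace_eq_sum_automorphisms]
      refine V.ge_sum _ _ _ fun g _ => S.ge_map g ?_
      refine V.ge_mono ?_ (V.ge_mul (V.ge_self y) hzs)
      omega
    apply hy0
    exact (traceForm_nondegenerate K L).1 y (fun z => by simpa [Algebra.traceForm_apply] using hz z)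
  have hle := LinearMap.finrank_le_finrank_of_injective hev
  rw [finrank_fin_fun, ← hedef, hq] at hle
  have hr1 : r = 1 := by
    have : r ≤ 1 := by
      by_contra h
      have : 2 * q ≤ r * q := Nat.mul_le_mul_right _ (by omega)
      omega
    omega
  exact ⟨t, ht0, by rw [hwt, hr1]; rfl⟩

theorem exists_RS (S : Pre p n K L V) [Fact p.Prime] [Algebra ℚ_[p] K] [FiniteDimensional ℚ_[p] K] :
    ∃ t : L, RS p K L V t := by
  obtain ⟨t, ht0, hwt⟩ := S.exists_t
  exact ⟨t, S.hp, S.inv, ht0, hwt, S.ge_p, S.res, S.tot⟩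
end Pre

end

/-! ### Part 10 -/

section
open Module

structure QV (L : Type) [Field L] where
  q : L → ℚ
  mul' : ∀ x y, x ≠ 0 → y ≠ 0 → q (x * y) = q x + q y
  add' : ∀ x y, x ≠ 0 → y ≠ 0 → x + y ≠ 0 → min (q x) (q y) ≤ q (x + y)

namespace QV
variable {L : Type} [Field L] (Q : QV L)

lemma q_one : Q.q 1 = 0 := by
  have := Q.mul' 1 1 one_ne_zero one_ne_zero
  rw [mul_one] at this; linarith

lemma q_inv {x : L} (hx : x ≠ 0) : Q.q x⁻¹ = - Q.q x := by
  have := Q.mul' x x⁻¹ hx (inv_ne_zero hx)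
  rw [mul_inv_cancel₀ hx, Q.q_one] at this; linarith

lemma q_pow {x : L} (hx : x ≠ 0) (k : ℕ) : Q.q (x ^ k) = k * Q.q x := by
  induction k with
  | zero => simp [Q.q_one]
  | succ k ih => rw [pow_succ, Q.mul' _ _ (pow_ne_zero _ hx) hx, ih]; push_cast; ring

lemma q_zpow {x : L} (hx : x ≠ 0) (k : ℤ) : Q.q (x ^ k) = k * Q.q x := by
  obtain ⟨k, rfl | rfl⟩ := k.eq_nat_or_neg
  · simp [Q.q_pow hx]
  · rw [zpow_neg, Q.q_inv (zpow_ne_zero _ hx), zpow_natCast, Q.q_pow hx]; push_cast; ring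

lemma q_prod {ι : Type*} (s : Finset ι) (f : ι → L) (h : ∀ i ∈ s, f i ≠ 0) :
    Q.q (∏ i ∈ s, f i) = ∑ i ∈ s, Q.q (f i) := by
  classical
  induction s using Finset.induction_on with
  | empty => simp [Q.q_one]
  | insert a s ha ih =>
    rw [Finset.prod_insert ha, Finset.sum_insert ha, Q.mul' _ _ (h a (by simp)), ih fun i hi => h i (by simp [hi])]
    exact Finset.prod_ne_zero_iff.mpr fun i hi => h i (by simp [hi])

variable {p n : ℕ} {K : Type} [Field K] [Algebra K L] 

lemma q_gal_le (hp0 : (p : L) ≠ 0) (hp1 : Q.q (p : L) = 1)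
    (hin : ∀ (g : L ≃ₐ[K] L) (x : L), x ≠ 0 → 0 ≤ Q.q x → g x - x ≠ 0 → 0 < Q.q (g x - x))
    (g : L ≃ₐ[K] L) (x : L) (hx : x ≠ 0) : Q.q x ≤ Q.q (g x) := by
  have hpos : ∀ y : L, y ≠ 0 → 0 ≤ Q.q y → 0 ≤ Q.q (g y) := by
    intro y hy h0
    by_cases h : g y - y = 0
    · rw [sub_eq_zero.mp h]; exact h0
    · have hg : g y ≠ 0 := (map_ne_zero _).mpr hy
      have := Q.add' (g y - y) y h hy (by simpa using hg)
      rw [sub_add_cancel] at this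
      exact (le_min (hin g y hy h0 h).le h0).trans this
  have hg : g x ≠ 0 := (map_ne_zero _).mpr hx
  set r := Q.q x with hr
  have h1 := hpos (x ^ r.den * (p : L) ^ (- r.num)) (mul_ne_zero (pow_ne_zero _ hx) (zpow_ne_zero _ hp0)) (by
    rw [Q.mul' _ _ (pow_ne_zero _ hx) (zpow_ne_zero _ hp0), Q.q_pow hx, Q.q_zpow hp0, hp1, ← hr]
    have := Rat.den_mul_eq_num r
    push_cast; linarith)
  rw [map_mul, map_pow, map_zpow₀, map_natCast, Q.mul' _ _ (pow_ne_zero _ hg) (zpow_ne_zero _ hp0), Q.q_pow hg,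
    Q.q_zpow hp0, hp1] at h1
  have := Rat.den_mul_eq_num r
  have hd : (0:ℚ) < r.den := by exact_mod_cast r.den_pos
  push_cast at h1
  nlinarith

theorem exists_Pre [FiniteDimensional K L] [IsGalois K L] (hp : p.Prime) (hodd : p ≠ 2) (hp0 : (p : L) ≠ 0) (hp1 : Q.q (p : L) = 1)
    (hin : ∀ (g : L ≃ₐ[K] L) (x : L), x ≠ 0 → 0 ≤ Q.q x → g x - x ≠ 0 → 0 < Q.q (g x - x))
    (hK : ∀ c : K, c ≠ 0 → 0 < Q.q (algebraMap K L c) → 1 ≤ Q.q (algebraMap K L c))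
    (hfr : finrank K L = (p - 1) * p ^ n) :
    ∃ V : DV L, Pre p n K L V ∧ ∀ x, x ≠ 0 → (V.w x : ℚ) = finrank K L * Q.q x := by
  have he : 0 < finrank K L := by
    rw [hfr]; have := hp.two_le
    exact Nat.mul_pos (by omega) (pow_pos hp.pos _)
  have heQ : (0:ℚ) < finrank K L := by exact_mod_cast he
  have hinv : ∀ (g : L ≃ₐ[K] L) (x : L), x ≠ 0 → Q.q (g x) = Q.q x := fun g x hx => by
    refine le_antisymm ?_ (Q.q_gal_le hp0 hp1 hin g x hx)
    have := Q.q_gal_le hp0 hp1 hin g⁻¹ (g x) ((map_ne_zero _).mpr hx)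
    rwa [show g⁻¹ (g x) = x from g.symm_apply_apply x] at this
  have hint : ∀ c : K, c ≠ 0 → ((⌊Q.q (algebraMap K L c)⌋ : ℤ) : ℚ) = Q.q (algebraMap K L c) := by
    intro c hc
    have hcL : algebraMap K L c ≠ 0 := (map_ne_zero _).mpr hc
    have hpK : (p : K) ≠ 0 := by intro h; apply hp0; rw [← map_natCast (algebraMap K L), h, map_zero]
    set r := Q.q (algebraMap K L c) with hr
    have h := hK (c * (p : K) ^ (-⌊r⌋)) (mul_ne_zero hc (zpow_ne_zero _ hpK))
    rw [map_mul, map_zpow₀, map_natCast, Q.mul' _ _ hcL (zpow_ne_zero _ hp0), Q.q_zpow hp0, hp1, ← hr] at h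
    have h1 := Int.floor_le r
    have h2 := Int.lt_floor_add_one r
    by_contra hne
    have : (⌊r⌋ : ℚ) < r := lt_of_le_of_ne h1 hne
    push_cast at h
    have := h (by linarith)
    linarith
  have hw : ∀ x : L, x ≠ 0 → ((⌊finrank K L * Q.q x⌋ : ℤ) : ℚ) = finrank K L * Q.q x := by
    intro x hx
    have hnorm : algebraMap K L (Algebra.norm K x) = ∏ g : L ≃ₐ[K] L, g x := Algebra.norm_eq_prod_automorphisms K x
    have hn0 : Algebra.norm K x ≠ 0 := Algebra.norm_ne_zero_iff.mpr hx
    have h1 : Q.q (algebraMap K L (Algebra.norm K x)) = finrank K L * Q.q x := by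
      rw [hnorm, Q.q_prod _ _ (fun g _ => (map_ne_zero _).mpr hx), Finset.sum_congr rfl fun g _ => hinv g x hx]
      rw [Finset.sum_const, Finset.card_univ, ← Nat.card_eq_fintype_card, IsGalois.card_aut_eq_finrank, nsmul_eq_mul]
    rw [← h1]; exact hint _ hn0
  let V : DV L :=
    { w := fun x => ⌊finrank K L * Q.q x⌋
      mul' := by
        intro x y hx hy
        have : (⌊finrank K L * Q.q (x * y)⌋ : ℚ) = ⌊finrank K L * Q.q x⌋ + ⌊finrank K L * Q.q y⌋ := by
          rw [hw x hx, hw y hy, hw _ (mul_ne_zero hx hy), Q.mul' x y hx hy]; ring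
        exact_mod_cast this
      add' := by
        intro x y hx hy hxy
        have h := Q.add' x y hx hy hxy
        rcases min_le_iff.mp h with h | h
        · exact (min_le_left _ _).trans (Int.floor_mono (by gcongr))
        · exact (min_le_right _ _).trans (Int.floor_mono (by gcongr)) }
  have hV : ∀ x, x ≠ 0 → (V.w x : ℚ) = finrank K L * Q.q x := fun x hx => hw x hx
  refine ⟨V, ⟨hp, hodd, ?_, hp0, ?_, ?_, ?_, hfr⟩, hV⟩
  · intro g x
    by_cases hx : x = 0
    · simp [hx]
    · have : (V.w (g x) : ℚ) = V.w x := by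
        rw [hV x hx, hV (g x) ((map_ne_zero g).mpr hx), hinv g x hx]
      exact_mod_cast this
  · have := hV _ hp0
    rw [hp1, mul_one] at this
    exact_mod_cast this
  · intro g x hx
    by_cases h0 : x = 0
    · left; simp [h0]
    by_cases h1 : g x - x = 0
    · left; exact h1
    right
    have hx' : 0 ≤ V.w x := hx.resolve_left h0
    have h2 : (0:ℚ) ≤ V.w x := by exact_mod_cast hx'
    rw [hV x h0] at h2
    have h3 := hin g x h0 (nonneg_of_mul_nonneg_right h2 heQ) h1
    have h4 : (0:ℚ) < V.w (g x - x) := by rw [hV _ h1]; positivity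
    have : 0 < V.w (g x - x) := by exact_mod_cast h4
    omega
  · intro c hc
    refine ⟨⌊Q.q (algebraMap K L c)⌋, ?_⟩
    have : (V.w (algebraMap K L c) : ℚ) = finrank K L * (⌊Q.q (algebraMap K L c)⌋ : ℤ) := by
      rw [hV _ ((map_ne_zero _).mpr hc), hint c hc]
    exact_mod_cast this
end QV

end

/-! ### Part 11 -/

section
open Module

namespace Tr
variable {p : ℕ} {A : Type} [Field A] (vd : PadicValData A p) {K L : Type} [Field K] [Field L] [Algebra K L]
  (emb : L →+* A)

noncomputable def qv (x : L) : ℚ := (vd.v (emb x)).untopD 0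

lemma hq {x : L} (hx : x ≠ 0) : vd.v (emb x) = (qv vd emb x : WithTop ℚ) := by
  have h : vd.v (emb x) ≠ ⊤ := by
    rw [Ne, vd.v_top_iff]; exact (map_ne_zero emb).mpr hx
  obtain ⟨r, hr⟩ := WithTop.ne_top_iff_exists.mp h
  rw [qv, ← hr]; rfl

lemma v_zero : vd.v (emb 0) = ⊤ := by rw [vd.v_top_iff, map_zero]

noncomputable def Q : QV L where
  q := qv vd emb
  mul' x y hx hy := by
    have h := vd.v_mul (emb x) (emb y)
    rw [← map_mul, hq vd emb hx, hq vd emb hy, hq vd emb (mul_ne_zero hx hy)] at h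
    exact_mod_cast h
  add' x y hx hy hxy := by
    have h := vd.v_min_le_add (emb x) (emb y)
    rw [← map_add, hq vd emb hx, hq vd emb hy, hq vd emb hxy] at h
    exact_mod_cast h

lemma p_ne {p : ℕ} {A : Type} [Field A] (vd : PadicValData A p) {L : Type} [Field L] (emb : L →+* A) :
    (p : L) ≠ 0 := by
  intro h
  have h1 := vd.v_coe_p
  rw [← map_natCast emb, h, v_zero] at h1
  exact absurd h1 (by exact WithTop.top_ne_one)

lemma q_p : (Q vd emb).q (p : L) = 1 := by
  have h1 := vd.v_coe_p
  rw [← map_natCast emb, hq vd emb (p_ne vd emb)] at h1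
  exact_mod_cast h1

lemma nonneg_iff (x : L) : 0 ≤ vd.v (emb x) ↔ x = 0 ∨ 0 ≤ (Q vd emb).q x := by
  by_cases hx : x = 0
  · simp [hx, (vd.v_top_iff 0).mpr rfl]
  · rw [hq vd emb hx]; simp only [hx, false_or]; exact WithTop.coe_nonneg

lemma pos_iff (x : L) : 0 < vd.v (emb x) ↔ x = 0 ∨ 0 < (Q vd emb).q x := by
  by_cases hx : x = 0
  · simp [hx, (vd.v_top_iff 0).mpr rfl]
  · rw [hq vd emb hx]; simp only [hx, false_or]; exact WithTop.coe_pos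

lemma in_of_succ {j : ℕ} {y : A} (h : InMaxIdealPow vd emb (j+1) y) : InMaxIdealPow vd emb j y := by
  obtain ⟨u, s, hu, hs, rfl⟩ := h
  refine ⟨u * s 0, fun k => s k.succ, ?_, fun k => hs _, ?_⟩
  · rw [map_mul, vd.v_mul]; exact add_nonneg hu (hs 0).le
  · rw [Fin.prod_univ_succ, map_mul, mul_assoc]

lemma in_mono {i j : ℕ} (hij : i ≤ j) {y : A} (h : InMaxIdealPow vd emb j y) : InMaxIdealPow vd emb i y := by
  induction j, hij using Nat.le_induction with
  | base => exact h
  | succ j hj ih => exact ih (in_of_succ vd emb h)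

lemma in_zero (j : ℕ) : InMaxIdealPow vd emb j 0 := by
  refine ⟨0, fun _ => 0, ?_, fun _ => ?_, by simp⟩ <;> rw [v_zero] <;> simp

lemma in_one {y : L} (h : InMaxIdealPow vd emb 1 (emb y)) : 0 < vd.v (emb y) := by
  obtain ⟨u, s, hu, hs, h⟩ := h
  rw [h, vd.v_mul]; simp only [Fin.prod_univ_one]
  exact lt_of_lt_of_le (hs 0) (le_add_of_nonneg_left hu)

lemma low_anti : Antitone (lowerRamSet vd K L emb) := by
  intro i j hij g hg x hx
  exact in_mono vd emb (by omega) (hg x hx)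

lemma one_low (i : ℤ) : (1 : L ≃ₐ[K] L) ∈ lowerRamSet vd K L emb i := by
  intro x _
  simpa using in_zero vd emb _

variable [FiniteDimensional K L]

lemma c_anti : Antitone (fun i => Nat.card ↥(lowerRamSet vd K L emb i)) := by
  intro i j hij
  exact Nat.card_mono (Set.toFinite _) (low_anti vd emb hij)

lemma c_pos (i : ℤ) : 1 ≤ Nat.card ↥(lowerRamSet vd K L emb i) := by
  have : Nonempty ↥(lowerRamSet vd K L emb i) := ⟨⟨1, one_low vd emb i⟩⟩
  exact Nat.card_pos

lemma upper_zero : upperRamSet vd K L emb 0 = lowerRamSet vd K L emb 0 := by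
  have h : herbrandPsi vd K L emb ((0:ℤ) : ℝ) = 0 := by
    rw [Int.cast_zero]
    exact Herb.psi_zero (c_anti vd emb) (c_pos vd emb)
  rw [upperRamSet, h, Int.ceil_zero]

lemma card_upper {n : ℕ} (h : RamCond vd K L emb n) (k : ℕ) (hk : k ≤ n) :
    Nat.card ↥(upperRamSet vd K L emb ((n : ℤ) + 1 - k)) = p ^ k := by
  induction k with
  | zero => 
    rw [show ((n : ℤ) + 1 - (0:ℕ)) = n + 1 by simp, h.2.2.2.2.2]; simp
  | succ k ih =>
    have h1 := h.2.2.2.2.1 (n - k) (by omega) (by omega)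
    have e1 : (((n - k : ℕ) : ℤ)) = (n : ℤ) + 1 - ((k + 1 : ℕ) : ℤ) := by omega
    have e2 : (n : ℤ) + 1 - ((k + 1 : ℕ) : ℤ) + 1 = n + 1 - k := by push_cast; ring
    rw [e1, e2, ih (by omega)] at h1
    rw [h1, pow_succ, mul_comm]

lemma card_upper_one {n : ℕ} (h : RamCond vd K L emb n) : Nat.card ↥(upperRamSet vd K L emb 1) = p ^ n := by
  have := card_upper vd emb h n le_rfl
  rwa [show ((n : ℤ) + 1 - n) = 1 by ring] at this

lemma finrank_eq [IsGalois K L] {n : ℕ} (h : RamCond vd K L emb n) : finrank K L = (p - 1) * p ^ n := by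
  rw [← card_upper_one vd emb h, ← h.2.2.2.1, h.2.1, ← IsGalois.card_aut_eq_finrank]
  exact Nat.card_univ.symm

theorem exists_V [Fact p.Prime] (hp : Odd p) [IsGalois K L]
    (hunram : IsUniformizer vd (emb.comp (algebraMap K L)) (p : K))
    {n : ℕ} (hram : RamCond vd K L emb n) :
    ∃ V : DV L, Pre p n K L V ∧ ∀ x, x ≠ 0 → (V.w x : ℚ) = finrank K L * (Q vd emb).q x := by
  have hpp : p.Prime := Fact.out
  refine (Q vd emb).exists_Pre hpp (by rintro rfl; exact absurd hp (by decide)) (p_ne vd emb) (q_p vd emb) ?_ ?_ (finrank_eq vd emb hram)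
  · intro g x hx h0 hgx
    have hg : g ∈ lowerRamSet vd K L emb 0 := by
      rw [← upper_zero, hram.2.1]; trivial
    have := hg x ((nonneg_iff vd emb x).mpr (Or.inr h0))
    rw [← map_sub] at this
    exact ((pos_iff vd emb _).mp (in_one vd emb this)).resolve_left hgx
  · intro c hc h0
    have h := hunram.2.2 c ((pos_iff vd emb _).mpr (Or.inr h0))
    have hcL : algebraMap K L c ≠ 0 := (map_ne_zero _).mpr hc
    rw [map_natCast, vd.v_coe_p, RingHom.comp_apply, hq vd emb hcL] at h
    exact_mod_cast h
end Tr

end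

/-! ### Part 12 -/

section
open Module

namespace Tr
section
variable {p n : ℕ} {A : Type} [Field A] {vd : PadicValData A p} {K L : Type} [Field K] [Field L] [Algebra K L]
  {emb : L →+* A} {V : DV L} {t : L}

lemma ge0_iff (S : Pre p n K L V) (hV : ∀ x, x ≠ 0 → (V.w x : ℚ) = finrank K L * (Q vd emb).q x) (x : L) :
    0 ≤ vd.v (emb x) ↔ V.Ge 0 x := by
  rw [nonneg_iff, DV.Ge]
  by_cases hx : x = 0
  · simp [hx]
  have he : (0:ℚ) < finrank K L := by exact_mod_cast S.e_pos
  have h := hV x hx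
  simp only [hx, false_or]
  rw [← mul_nonneg_iff_of_pos_left he, ← h]
  exact_mod_cast Iff.rfl

lemma ge1_iff (S : Pre p n K L V) (hV : ∀ x, x ≠ 0 → (V.w x : ℚ) = finrank K L * (Q vd emb).q x) (x : L) :
    0 < vd.v (emb x) ↔ V.Ge 1 x := by
  rw [pos_iff, DV.Ge]
  by_cases hx : x = 0
  · simp [hx]
  have he : (0:ℚ) < finrank K L := by exact_mod_cast S.e_pos
  have h := hV x hx
  simp only [hx, false_or]
  rw [← mul_pos_iff_of_pos_left he, ← h, Int.cast_pos]
  rfl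

lemma in_iff (S : Pre p n K L V) (R : RS p K L V t)
    (hV : ∀ x, x ≠ 0 → (V.w x : ℚ) = finrank K L * (Q vd emb).q x) (j : ℕ) (y : L) :
    InMaxIdealPow vd emb j (emb y) ↔ V.Ge j y := by
  constructor
  · rintro ⟨u, s, hu, hs, h⟩
    rw [← map_prod, ← map_mul] at h
    rw [emb.injective h]
    have h2 : ∀ (j : ℕ) (s : Fin j → L), (∀ k, V.Ge 1 (s k)) → V.Ge j (∏ k, s k) := by
      intro j
      induction j with
      | zero => intro s _; simpa using V.ge_one
      | succ j ih =>
        intro s hs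
        rw [Fin.prod_univ_succ]
        have := V.ge_mul (hs 0) (ih (fun k => s k.succ) fun k => hs _)
        rw [add_comm] at this
        push_cast; exact this
    have := V.ge_mul ((ge0_iff S hV u).mp hu) (h2 j s fun k => (ge1_iff S hV _).mp (hs k))
    simpa using this
  · intro h
    refine ⟨y / t ^ j, fun _ => t, ?_, fun _ => ?_, ?_⟩
    · rw [ge0_iff S hV]
      have ht := pow_ne_zero j R.t0
      by_cases hy : y = 0
      · left; simp [hy]
      · right
        rw [V.w_div hy ht, V.w_pow R.t0, R.wt]
        have := h.resolve_left hy
        omega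
    · rw [ge1_iff S hV]; exact R.ge_t
    · rw [Finset.prod_const, Finset.card_univ, Fintype.card_fin, ← map_pow, ← map_mul,
        div_mul_cancel₀ _ (pow_ne_zero j R.t0)]

lemma low_iff (S : Pre p n K L V) (R : RS p K L V t)
    (hV : ∀ x, x ≠ 0 → (V.w x : ℚ) = finrank K L * (Q vd emb).q x) (s : ℤ) (g : L ≃ₐ[K] L) :
    g ∈ lowerRamSet vd K L emb s ↔ V.Ge ((s+1).toNat : ℕ) (g t - t) := by
  constructor
  · intro h
    have := h t ((ge0_iff S hV t).mpr (V.ge_mono (by norm_num) R.ge_t))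
    rw [← map_sub] at this
    exact (in_iff S R hV _ _).mp this
  · intro h x hx
    rw [← map_sub, in_iff S R hV]
    exact R.R0 g h x ((ge0_iff S hV x).mp hx)

lemma low_mul (S : Pre p n K L V) (R : RS p K L V t)
    (hV : ∀ x, x ≠ 0 → (V.w x : ℚ) = finrank K L * (Q vd emb).q x) (s : ℤ) (g h : L ≃ₐ[K] L)
    (hg : g ∈ lowerRamSet vd K L emb s) (hh : h ∈ lowerRamSet vd K L emb s) :
    g * h ∈ lowerRamSet vd K L emb s := by
  rw [low_iff S R hV] at hg hh ⊢
  have : (g * h) t - t = g (h t - t) + (g t - t) := by simp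
  rw [this]
  exact V.ge_add (R.ge_map g hh) hg

lemma low_pow (S : Pre p n K L V) (R : RS p K L V t)
    (hV : ∀ x, x ≠ 0 → (V.w x : ℚ) = finrank K L * (Q vd emb).q x) (s : ℤ) (g : L ≃ₐ[K] L)
    (hg : g ∈ lowerRamSet vd K L emb s) (k : ℕ) : g ^ k ∈ lowerRamSet vd K L emb s := by
  induction k with
  | zero => exact one_low vd emb s
  | succ k ih => rw [pow_succ]; exact low_mul S R hV s _ _ ih hg

variable [FiniteDimensional K L]

lemma order_gamma (S : Pre p n K L V) (R : RS p K L V t)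
    (hV : ∀ x, x ≠ 0 → (V.w x : ℚ) = finrank K L * (Q vd emb).q x) (hram : RamCond vd K L emb n)
    (γ : L ≃ₐ[K] L) (hγ : γ ∈ upperRamSet vd K L emb 1)
    (hγgen : ∀ h ∈ upperRamSet vd K L emb 1, ∃ k : ℕ, h = γ ^ k) : orderOf γ = p ^ n := by
  rw [← card_upper_one vd emb hram, ← Nat.card_zpowers]
  have : (Subgroup.zpowers γ : Set (L ≃ₐ[K] L)) = upperRamSet vd K L emb 1 := by
    ext g
    constructor
    · intro hg
      obtain ⟨k, rfl⟩ := (mem_powers_iff_mem_zpowers (x := γ)).mpr hg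
      exact low_pow S R hV _ _ hγ k
    · intro hg
      obtain ⟨k, rfl⟩ := hγgen g hg
      exact Subgroup.npow_mem_zpowers γ k
  rw [← this]; rfl

lemma ram_le [IsGalois K L] (R : RS p K L V t) (hab : ∀ σ τ : L ≃ₐ[K] L, σ * τ = τ * σ) (γ : L ≃ₐ[K] L) (N : ℕ)
    (ho : orderOf γ = p ^ (N+1)) (hc : finrank K L = (p - 1) * p ^ (N+1)) (g : L ≃ₐ[K] L) (hg : g ≠ 1) :
    V.w (g t - t) ≤ V.w ((γ ^ (p ^ N)) t - t) := by
  obtain ⟨h2, hout, -⟩ := R.tame hab γ N ho hc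
  have hN : γ ^ (p ^ N) ≠ 1 := by
    intro h
    have := orderOf_dvd_of_pow_eq_one h
    rw [ho, Nat.pow_dvd_pow_iff_le_right R.hp.one_lt] at this
    omega
  have h2N := R.two_le γ h2 _ hN
  by_cases hz : g ∈ Subgroup.zpowers γ
  · obtain ⟨k, rfl⟩ := (mem_powers_iff_mem_zpowers (x := γ)).mpr hz
    simp only at hg ⊢
    rw [R.w_pow_eq γ h2 k hg]
    have hle : padicValNat p k ≤ N := by
      by_contra hlt
      apply hg
      rw [← orderOf_dvd_iff_pow_eq_one, ho]
      exact (pow_dvd_pow p (by omega)).trans pow_padicValNat_dvd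
    have e : γ ^ (p ^ N) = (γ ^ (p ^ (padicValNat p k))) ^ (p ^ (N - padicValNat p k)) := by
      rw [← pow_mul, ← pow_add]; congr 2; omega
    have h1 : γ ^ (p ^ (padicValNat p k)) ≠ 1 := by
      intro h; rw [e, h, one_pow] at hN; exact hN rfl
    apply V.le_w (R.gt_sub_ne hN)
    rw [e]
    exact R.R3_ge _ (R.two_le γ h2 _ h1) (V.ge_self _) _
  · rw [hout g hz]; omega

lemma phi_bound [IsGalois K L] (N : ℕ) (S : Pre p (N+1) K L V) (R : RS p K L V t)
    (hV : ∀ x, x ≠ 0 → (V.w x : ℚ) = finrank K L * (Q vd emb).q x) (hram : RamCond vd K L emb (N+1))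
    (hab : ∀ σ τ : L ≃ₐ[K] L, σ * τ = τ * σ) (γ : L ≃ₐ[K] L)
    (ho : orderOf γ = p ^ (N+1)) :
    Arith.SS p (RS.II V t p γ) (N+1) + RS.II V t p γ N < (N + 2) * finrank K L := by
  classical
  have hc := S.fr
  obtain ⟨h2, hout, -⟩ := R.tame hab γ N ho hc
  have hN : γ ^ (p ^ N) ≠ 1 := by
    intro h
    have := orderOf_dvd_of_pow_eq_one h
    rw [ho, Nat.pow_dvd_pow_iff_le_right R.hp.one_lt] at this
    omega
  have h2N := R.two_le γ h2 _ hN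
  obtain ⟨T, hT⟩ : ∃ T : ℕ, RS.II V t p γ N = T := ⟨(RS.II V t p γ N).toNat, by
    rw [Int.toNat_of_nonneg]; unfold RS.II; omega⟩
  have hT' : V.w ((γ ^ (p ^ N)) t - t) = T + 1 := by unfold RS.II at hT; omega
  have hmem : ∀ (g : L ≃ₐ[K] L) (s : ℕ), g ≠ 1 → (g ∈ lowerRamSet vd K L emb s ↔ (s : ℤ) + 1 ≤ V.w (g t - t)) := by
    intro g s hg
    rw [low_iff S R hV, DV.Ge]
    simp only [R.gt_sub_ne hg, false_or]
    have : (((s : ℤ) + 1).toNat : ℤ) = s + 1 := by omega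
    rw [this]
  have hb := Herb.bound (c_anti (K := K) vd emb) (c_pos vd emb) T (((N + 1 : ℕ) : ℤ) + 1 : ℤ) (by
    have h1 : Nat.card ↥(upperRamSet vd K L emb (((N + 1 : ℕ) : ℤ) + 1)) = 1 := by rw [hram.2.2.2.2.2]; simp
    change Nat.card ↥(upperRamSet vd K L emb (((N + 1 : ℕ) : ℤ) + 1)) < _
    rw [h1]
    show 1 < Nat.card ↥(lowerRamSet vd K L emb T)
    rw [Finite.one_lt_card_iff_nontrivial]
    exact ⟨⟨1, one_low vd emb _⟩, ⟨γ ^ (p ^ N), (hmem _ T hN).mpr hT'.ge⟩, fun h => hN (congrArg Subtype.val h).symm⟩)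
  have hc0 : Nat.card ↥(lowerRamSet vd K L emb 0) = finrank K L := by
    rw [← upper_zero, hram.2.1, ← IsGalois.card_aut_eq_finrank]; exact Nat.card_univ
  rw [hc0] at hb
  have hb' : ∑ s ∈ Finset.range T, (Nat.card ↥(lowerRamSet vd K L emb (s + 1)) : ℤ) < (N + 2) * finrank K L := by
    have : ((∑ s ∈ Finset.range T, (Nat.card ↥(lowerRamSet vd K L emb (s + 1)) : ℤ) : ℤ) : ℝ) < (((N + 2) * finrank K L : ℤ) : ℝ) := by
      push_cast at hb ⊢
      calc _ < _ := hb
        _ = _ := by ring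
    exact_mod_cast this
  refine lt_of_le_of_lt ?_ hb'
  rw [hT, ← R.sum_ram hab γ N ho hc]
  have hcard : ∀ s : ℤ, (Nat.card ↥(lowerRamSet vd K L emb s) : ℤ) = ∑ g : L ≃ₐ[K] L, if g ∈ lowerRamSet vd K L emb s then 1 else 0 := by
    intro s
    rw [Finset.sum_ite, Nat.card_eq_fintype_card, Fintype.card_subtype]; simp
  simp only [hcard]
  rw [Finset.sum_comm]
  have hTs : (T : ℤ) = ∑ g : L ≃ₐ[K] L, if g = 1 then (T:ℤ) else 0 := by simp
  rw [hTs, ← Finset.sum_add_distrib]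
  apply Finset.sum_le_sum
  intro g _
  by_cases hg : g = 1
  · subst hg
    simp [one_low]
  · simp only [hg, if_false, add_zero]
    have hle := ram_le R hab γ N ho hc g hg
    obtain ⟨r, hr⟩ : ∃ r : ℕ, V.w (g t - t) = r + 1 := by
      have := (R.ge_one_gt g).resolve_left (R.gt_sub_ne hg)
      exact ⟨(V.w (g t - t) - 1).toNat, by omega⟩
    have hrT : r ≤ T := by omega
    rw [hr]
    calc ((r : ℤ) + 1 - 1) = ∑ s ∈ Finset.range r, (1 : ℤ) := by simp
      _ = ∑ s ∈ Finset.range r, if g ∈ lowerRamSet vd K L emb (s + 1) then (1:ℤ) else 0 := by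
        refine Finset.sum_congr rfl fun s hs => ?_
        rw [if_pos]
        have := (hmem g (s+1) hg).mpr (by rw [hr]; have := Finset.mem_range.mp hs; push_cast; omega)
        exact_mod_cast this
      _ ≤ _ := by
        refine Finset.sum_le_sum_of_subset_of_nonneg (Finset.range_mono hrT) fun s _ _ => ?_
        split_ifs <;> norm_num
end
end Tr

end

section

/-- Proposition 2.8. Let `L/K` satisfy condition (ram) with parameter
`n ≥ 1`, with `G^1` cyclic with generator `γ` and `K` unramified over `ℚ_p`.  Put
`S^1 = {γ^i : 0 ≤ i ≤ p^{n−1}−1}` and `X = {x ∈ m_L : v_L(x) < p}` (i.e. `x ∈ m_L`,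
`x ∉ m_L^p`).  Then for any `α ∈ O_K + X` there exists `β ∈ O_L` such that
`v_π(∑_{σ ∈ S^1} Tr_{L/K}(α^σ β)) = n`. -/
theorem statement9 {p : ℕ} [Fact p.Prime] (hp : Odd p)
    {A : Type} [Field A] (vd : PadicValData A p)
    (K L : Type) [Field K] [Field L]
    [Algebra ℚ_[p] K] [FiniteDimensional ℚ_[p] K]
    [Algebra K L] [FiniteDimensional K L] [IsGalois K L]
    (emb : L →+* A)
    (hab : ∀ σ τ : L ≃ₐ[K] L, σ * τ = τ * σ)
    (π : K) (hπ : IsUniformizer vd (emb.comp (algebraMap K L)) π)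
    (hunram : IsUniformizer vd (emb.comp (algebraMap K L)) (p : K))
    (n : ℕ) (hn : 1 ≤ n) (hram : RamCond vd K L emb n)
    (γ : L ≃ₐ[K] L) (hγ : γ ∈ upperRamSet vd K L emb 1)
    (hγgen : ∀ h ∈ upperRamSet vd K L emb 1, ∃ k : ℕ, h = γ ^ k)
    (a : K) (ha : 0 ≤ vd.v ((emb.comp (algebraMap K L)) a))
    (x : L) (hx1 : InMaxIdealPow vd emb 1 (emb x)) (hxp : ¬ InMaxIdealPow vd emb p (emb x))
    (α : L) (hα : α = algebraMap K L a + x) :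
    ∃ β : L, 0 ≤ vd.v (emb β) ∧
      vd.v ((emb.comp (algebraMap K L))
          (∑ i ∈ Finset.range (p ^ (n - 1)), Algebra.trace K L ((γ ^ i) α * β)))
        = n • vd.v ((emb.comp (algebraMap K L)) π) := by
  have hpp : p.Prime := Fact.out
  obtain ⟨N, rfl⟩ : ∃ N, n = N + 1 := ⟨n - 1, by omega⟩
  obtain ⟨V, S, hV⟩ := Tr.exists_V vd emb hp hunram hram
  obtain ⟨t, R⟩ := S.exists_RS
  have ho := Tr.order_gamma S R hV hram γ hγ hγgen
  have hphi := Tr.phi_bound N S R hV hram hab γ ho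
  have hxp' : ¬ V.Ge p x := fun h => hxp ((Tr.in_iff S R hV p x).mpr h)
  have hx0 : x ≠ 0 := fun h => hxp' (Or.inl h)
  have hx1' : V.Ge ((1 : ℕ) : ℤ) x := (Tr.in_iff S R hV 1 x).mp hx1
  obtain ⟨β, hβ, hsum⟩ := R.core hab γ N ho S.fr S.p0 S.wp hphi a
    ((Tr.ge0_iff S hV _).mp ha) x hx0 (by simpa using hx1'.resolve_left hx0)
    (by by_contra h; exact hxp' (Or.inr (not_lt.mp h)))
  refine ⟨β, (Tr.ge0_iff S hV β).mpr hβ, ?_⟩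
  subst hα
  rw [Nat.add_sub_cancel, hsum]
  have hvp : vd.v ((emb.comp (algebraMap K L)) (p : K)) = 1 := by
    rw [map_natCast]; exact vd.v_coe_p
  have hvπ : vd.v ((emb.comp (algebraMap K L)) π) = 1 := by
    rw [← hvp]
    exact le_antisymm (hπ.2.2 _ hunram.2.1) (hunram.2.2 _ hπ.2.1)
  rw [hvπ]
  have hpow : ∀ k : ℕ, vd.v ((emb.comp (algebraMap K L)) ((p : K) ^ (k + 1))) = (k + 1) • (1 : WithTop ℚ) := by
    intro k
    induction k with
    | zero => rw [zero_add, pow_one, hvp, one_smul]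
    | succ k ih => rw [pow_succ, map_mul, vd.v_mul, ih, hvp, succ_nsmul (1 : WithTop ℚ) (k + 1)]
  exact hpow N

end
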